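/- For every positive integer n, the number of representations of n by the octonary quadratic form x1^2 + 2x2^2 + 4x3^2 + 4x4^2 + 4x5^2 + 4x6^2 + 4x7^2 + 4x8^2 equals (2/11)σ_{3;χ8,1}(n) + (2/11)σ_{3;1,χ8}(n/2) + (6/11)a1(n) + (14/11)a2(n) + (48/11)a1(n/2) − (28/11)a2(n/2), where terms with non-integer argument n/2 are interpreted as 0. -/

import Mathlib

open Complex Real Finset

/-- The Dedekind eta function `η(z) = q^{1/24} ∏ (1 - q^m)`, `q = e^{2πiz}`. -/
noncomputable def dedekindEta (z : ℂ) : ℂ :=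
  Complex.exp (Real.pi * Complex.I * z / 12) *
    ∏' m : ℕ, (1 - Complex.exp (2 * Real.pi * Complex.I * (m + 1) * z))

/-- `repCount a n` is the number of `(x₁,…,x₈) ∈ ℤ⁸` with `∑ aᵢ xᵢ² = n`. -/
noncomputable def repCount (a : Fin 8 → ℕ) (n : ℕ) : ℕ :=
  Nat.card {x : Fin 8 → ℤ // ∑ i, (a i : ℤ) * x i ^ 2 = (n : ℤ)}

/-- `σ_{3;1,χ₈}(n) = ∑_{d ∣ n} χ₈(d) d³`. -/
def sigmaOneChi8 (n : ℕ) : ℤ := ∑ d ∈ n.divisors, ZMod.χ₈ (d : ZMod 8) * (d : ℤ) ^ 3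

/-- `σ_{3;χ₈,1}(n) = ∑_{d ∣ n} χ₈(n/d) d³`. -/
def sigmaChi8One (n : ℕ) : ℤ := ∑ d ∈ n.divisors, ZMod.χ₈ ((n / d : ℕ) : ZMod 8) * (d : ℤ) ^ 3

/-- `f(n/2)` when `2 ∣ n`, and `0` otherwise. -/
def half (f : ℕ → ℤ) (n : ℕ) : ℚ := if 2 ∣ n then (f (n / 2) : ℚ) else 0

namespace RF

lemma zsum_of_nat {f : ℤ → ℝ} (h1 : Summable fun n : ℕ => f n) (h2 : Summable fun n : ℕ => f (-(n:ℤ))) :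
    Summable f := Summable.of_nat_of_neg h1 h2

/-- summability of `q^(n^2) t^n` over the naturals. -/
lemma summable_theta_nat {q t : ℝ} (hq0 : 0 < q) (hq1 : q < 1) :
    Summable fun n : ℕ => q ^ (n ^ 2) * t ^ n := by
  by_cases ht : t = 0
  · subst ht
    apply summable_of_ne_finset_zero (s := {0})
    intro b hb
    simp at hb
    simp [hb]
  · apply summable_of_ratio_test_tendsto_lt_one (l := 0) (by norm_num)
    · exact Filter.Eventually.of_forall fun n => by positivity
    · have : ∀ n : ℕ, ‖q ^ ((n+1) ^ 2) * t ^ (n+1)‖ / ‖q ^ (n ^ 2) * t ^ n‖ = (q * |t|) * (q^2) ^ n := by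
        intro n
        simp only [norm_mul, norm_pow, Real.norm_eq_abs, abs_of_pos hq0]
        have : |t| ≠ 0 := by simpa using ht
        field_simp
        ring
      simp_rw [this]
      have h := (tendsto_pow_atTop_nhds_zero_of_lt_one (r := q^2) (by positivity) (by nlinarith)).const_mul (q*|t|)
      simpa using h

lemma summable_theta {q t : ℝ} (hq0 : 0 < q) (hq1 : q < 1) :
    Summable fun n : ℤ => q ^ (n ^ 2) * t ^ n := by
  apply zsum_of_nat
  · refine (summable_theta_nat (t := t) hq0 hq1).congr fun n => ?_
    norm_cast
  · refine (summable_theta_nat (t := t⁻¹) hq0 hq1).congr fun n => ?_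
    rw [neg_sq, zpow_neg, zpow_natCast, inv_pow]
    norm_cast

/-- the theta series -/
noncomputable def th (q t : ℝ) : ℝ := ∑' n : ℤ, q ^ (n ^ 2) * t ^ n

lemma hasSum_th {q t : ℝ} (hq0 : 0 < q) (hq1 : q < 1) :
    HasSum (fun n : ℤ => q ^ (n ^ 2) * t ^ n) (th q t) := (summable_theta hq0 hq1).hasSum

/-! ### Jacobi triple product -/

noncomputable def PQ (Q : ℝ) (n : ℕ) : ℝ := ∏ j ∈ range n, (1 - Q ^ (j + 1))

noncomputable def invP (Q : ℝ) (n : ℤ) : ℝ := if n < 0 then 0 else (PQ Q n.toNat)⁻¹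

lemma one_sub_pos {Q : ℝ} (hQ0 : 0 < Q) (hQ1 : Q < 1) (j : ℕ) : 0 < 1 - Q ^ (j+1) := by
  have := pow_lt_one₀ hQ0.le hQ1 (Nat.succ_ne_zero j)
  simpa using this

lemma PQ_pos {Q : ℝ} (hQ0 : 0 < Q) (hQ1 : Q < 1) (n : ℕ) : 0 < PQ Q n :=
  prod_pos fun j _ => one_sub_pos hQ0 hQ1 j

lemma invP_rec {Q : ℝ} (hQ0 : 0 < Q) (hQ1 : Q < 1) (n : ℤ) :
    invP Q (n - 1) = (1 - Q ^ n) * invP Q n := by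
  rcases lt_trichotomy n 0 with h | h | h
  · simp [invP, h, show n - 1 < 0 by omega]
  · subst h; simp [invP]
  · obtain ⟨k, rfl⟩ : ∃ k : ℕ, n = k + 1 := ⟨(n-1).toNat, by omega⟩
    have h1 : ¬ ((k:ℤ) + 1 < 0) := by omega
    have h2 : ¬ ((k:ℤ) < 0) := by omega
    have h3 : ((k:ℤ) + 1).toNat = k + 1 := by omega
    simp only [invP, add_sub_cancel_right, h1, h2, if_false, h3, Int.toNat_natCast]
    have h4 : Q ^ ((k:ℤ) + 1) = Q ^ (k+1) := by norm_cast
    rw [h4, show PQ Q (k+1) = PQ Q k * (1 - Q ^ (k+1)) from prod_range_succ _ _]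
    have := PQ_pos hQ0 hQ1 k
    have := one_sub_pos hQ0 hQ1 k
    field_simp

noncomputable def cJ (q : ℝ) (N : ℕ) (k : ℤ) : ℝ :=
  PQ (q^2) (2*N) * invP (q^2) (N + k) * invP (q^2) (N - k) * q ^ (k^2)

lemma cJ_rec {q : ℝ} (hq0 : 0 < q) (hq1 : q < 1) (N : ℕ) (k : ℤ) :
    cJ q (N+1) k = (1 + q ^ (4*N+2)) * cJ q N k
      + q ^ (2*N+1) * cJ q N (k-1) + q ^ (2*N+1) * cJ q N (k+1) := by
  have hQ0 : 0 < q^2 := by positivity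
  have hQ1 : q^2 < 1 := by nlinarith
  unfold cJ
  set A := invP (q^2) (N + 1 + k) with hA
  set B := invP (q^2) (N + 1 - k) with hB
  set u := (q^2) ^ ((N:ℤ) + 1 + k) with hu
  set v := (q^2) ^ ((N:ℤ) + 1 - k) with hv
  have e1 : invP (q^2) (N + k) = (1 - u) * A := by
    rw [hA, hu, ← invP_rec hQ0 hQ1]; congr 1; ring
  have e2 : invP (q^2) (N - k) = (1 - v) * B := by
    rw [hB, hv, ← invP_rec hQ0 hQ1]; congr 1; ring
  have e3 : invP (q^2) (N + (k-1)) = (1 - u / q^2) * ((1 - u) * A) := by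
    rw [← e1, hu, div_eq_mul_inv, ← zpow_sub_one₀ hQ0.ne', show (N:ℤ) + 1 + k - 1 = N + k by ring, ← invP_rec hQ0 hQ1]
    congr 1; ring
  have e4 : invP (q^2) (N - (k+1)) = (1 - v / q^2) * ((1 - v) * B) := by
    rw [← e2, hv, div_eq_mul_inv, ← zpow_sub_one₀ hQ0.ne', show (N:ℤ) + 1 - k - 1 = N - k by ring, ← invP_rec hQ0 hQ1]
    congr 1; ring
  have e5 : invP (q^2) (N - (k-1)) = B := by rw [hB]; congr 1; ring
  have e6 : invP (q^2) (N + (k+1)) = A := by rw [hA]; congr 1; ring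
  have e7 : invP (q^2) ((N+1:ℕ) + k) = A := by rw [hA]; push_cast; rfl
  have e8 : invP (q^2) ((N+1:ℕ) - k) = B := by rw [hB]; push_cast; rfl
  rw [e1, e2, e3, e4, e5, e6, e7, e8]
  have p1 : PQ (q^2) (2*(N+1)) = PQ (q^2) (2*N) * (1 - u * v / q^2) * (1 - u * v) := by
    rw [show 2*(N+1) = 2*N+1+1 by ring]
    unfold PQ
    rw [prod_range_succ, prod_range_succ]
    have : u * v = (q^2)^(2*N+1+1) := by
      rw [hu, hv, ← zpow_add₀ hQ0.ne', ← zpow_natCast (q^2) (2*N+1+1)]; congr 1; push_cast; ring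
    rw [this]
    congr 2
    field_simp
    ring
  have p2 : q ^ (2*N+1) * q ^ ((k-1)^2) = v * q ^ (k^2) := by
    rw [hv, ← zpow_natCast, ← zpow_natCast, ← zpow_mul, ← zpow_add₀ hq0.ne', ← zpow_add₀ hq0.ne']
    congr 1; push_cast; ring
  have p3 : q ^ (2*N+1) * q ^ ((k+1)^2) = u * q ^ (k^2) := by
    rw [hu, ← zpow_natCast, ← zpow_natCast, ← zpow_mul, ← zpow_add₀ hq0.ne', ← zpow_add₀ hq0.ne']
    congr 1; push_cast; ring
  have p4 : q ^ (4*N+2) = u * v / q^2 := by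
    rw [hu, hv, ← zpow_add₀ hQ0.ne', ← zpow_natCast, ← zpow_natCast, ← zpow_mul, ← zpow_sub₀ hq0.ne']
    congr 1; push_cast; ring
  rw [p1, p4]
  have : q ≠ 0 := hq0.ne'
  calc _ = PQ (q^2) (2*N) * A * B * q^(k^2) * ((1 - u * v / q^2) * (1 - u * v)) := by ring
    _ = PQ (q^2) (2*N) * A * B * q^(k^2) * ((1-u)*(1-v)*(1+u*v/q^2) + v*(1-u)*(1-u/q^2) + u*(1-v)*(1-v/q^2)) := by
        congr 1; field_simp; ring
    _ = (1 + u * v / q ^ 2) * (PQ (q ^ 2) (2 * N) * ((1 - u) * A) * ((1 - v) * B) * q ^ k ^ 2) +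
      PQ (q ^ 2) (2 * N) * ((1 - u / q ^ 2) * ((1 - u) * A)) * B * (v * q ^ k ^ 2) +
    PQ (q ^ 2) (2 * N) * A * ((1 - v / q ^ 2) * ((1 - v) * B)) * (u * q ^ k ^ 2) := by ring
    _ = _ := by rw [← p2, ← p3]; ring

lemma jtp_finite {q t : ℝ} (hq0 : 0 < q) (hq1 : q < 1) (ht : t ≠ 0) (N : ℕ) :
    HasSum (fun k : ℤ => cJ q N k * t ^ k)
      (∏ n ∈ range N, ((1 + q ^ (2*n+1) * t) * (1 + q ^ (2*n+1) * t⁻¹))) := by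
  induction N with
  | zero =>
    have : (fun k : ℤ => cJ q 0 k * t ^ k) = fun k => if k = 0 then 1 else 0 := by
      ext k
      by_cases hk : k = 0
      · subst hk; simp [cJ, invP, PQ]
      · rcases lt_or_gt_of_ne hk with h | h
        · simp [cJ, invP, h, hk]
        · simp [cJ, invP, h, hk]
    rw [this]
    simpa using hasSum_ite_eq (0:ℤ) (1:ℝ)
  | succ N ih =>
    rw [prod_range_succ]
    have h1 := (Equiv.subRight (1:ℤ)).hasSum_iff.mpr ih
    have h2 := (Equiv.addRight (1:ℤ)).hasSum_iff.mpr ih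
    have h := ((ih.mul_left (1 + q^(4*N+2))).add (h1.mul_left (q^(2*N+1) * t))).add
      (h2.mul_left (q^(2*N+1) * t⁻¹))
    have e1 : (∏ x ∈ range N, (1 + q ^ (2 * x + 1) * t) * (1 + q ^ (2 * x + 1) * t⁻¹)) *
        ((1 + q ^ (2 * N + 1) * t) * (1 + q ^ (2 * N + 1) * t⁻¹)) =
      (1 + q ^ (4 * N + 2)) * ∏ n ∈ range N, (1 + q ^ (2 * n + 1) * t) * (1 + q ^ (2 * n + 1) * t⁻¹) +
        q ^ (2 * N + 1) * t * ∏ n ∈ range N, (1 + q ^ (2 * n + 1) * t) * (1 + q ^ (2 * n + 1) * t⁻¹) +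
      q ^ (2 * N + 1) * t⁻¹ * ∏ n ∈ range N, (1 + q ^ (2 * n + 1) * t) * (1 + q ^ (2 * n + 1) * t⁻¹) := by
      generalize ∏ n ∈ range N, (1 + q ^ (2 * n + 1) * t) * (1 + q ^ (2 * n + 1) * t⁻¹) = X
      field_simp
      ring
    rw [e1]
    refine h.congr_fun fun k => ?_
    · rw [cJ_rec hq0 hq1]
      simp only [Function.comp, Equiv.subRight_apply, Equiv.coe_addRight]
      rw [zpow_sub_one₀ ht, zpow_add_one₀ ht]
      field_simp

lemma summable_pow_shift {q : ℝ} (hq0 : 0 < q) (hq1 : q < 1) (a b : ℕ) (ha : 0 < a) (c : ℝ) :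
    Summable fun n : ℕ => q ^ (a*n+b) * c := by
  have := (summable_geometric_of_lt_one (r := q^a) (by positivity) (pow_lt_one₀ hq0.le hq1 ha.ne')).mul_right (q^b * c)
  refine this.congr fun n => ?_
  rw [pow_add, pow_mul]; ring

lemma mult_one_add {q : ℝ} (hq0 : 0 < q) (hq1 : q < 1) (a b : ℕ) (ha : 0 < a) (c : ℝ) :
    Multipliable fun n : ℕ => (1 + q ^ (a*n+b) * c) := by
  apply Real.multipliable_one_add_of_summable
  exact summable_pow_shift hq0 hq1 a b ha c

/-- Euler product -/
noncomputable def Eu (q : ℝ) : ℝ := ∏' n : ℕ, (1 - q ^ (n+1))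

lemma Eu_mult {q : ℝ} (hq0 : 0 < q) (hq1 : q < 1) : Multipliable fun n : ℕ => (1 - q ^ (n+1)) := by
  refine (mult_one_add hq0 hq1 1 1 one_pos (-1)).congr fun n => ?_
  ring

lemma PQ_tendsto {q : ℝ} (hq0 : 0 < q) (hq1 : q < 1) :
    Filter.Tendsto (PQ q) Filter.atTop (nhds (Eu q)) :=
  (Eu_mult hq0 hq1).hasProd.tendsto_prod_nat

lemma Eu_pos {q : ℝ} (hq0 : 0 < q) (hq1 : q < 1) : 0 < Eu q := by
  have h0 : Eu q ≠ 0 := by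
    have := tprod_one_add_ne_zero_of_summable (f := fun n : ℕ => -q^(n+1)) (R := ℝ) ?_ ?_
    · simpa [Eu, sub_eq_add_neg] using this
    · intro n; have := one_sub_pos hq0 hq1 n; simpa [sub_eq_add_neg] using this.ne'
    · have := (summable_pow_shift hq0 hq1 1 1 one_pos 1)
      simpa [abs_of_pos hq0] using this
  have : 0 ≤ Eu q := ge_of_tendsto' (PQ_tendsto hq0 hq1) fun n => (PQ_pos hq0 hq1 n).le
  exact lt_of_le_of_ne this h0.symm

lemma PQ_le_one {q : ℝ} (hq0 : 0 < q) (hq1 : q < 1) (n : ℕ) : PQ q n ≤ 1 := by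
  apply prod_le_one
  · intro j _; exact (one_sub_pos hq0 hq1 j).le
  · intro j _; have : 0 < q^(j+1) := by positivity
    linarith

lemma Eu_le_PQ {q : ℝ} (hq0 : 0 < q) (hq1 : q < 1) (n : ℕ) : Eu q ≤ PQ q n := by
  have hanti : Antitone (PQ q) := by
    apply antitone_nat_of_succ_le
    intro n
    rw [show PQ q (n+1) = PQ q n * (1 - q ^ (n+1)) from prod_range_succ _ _]
    have := PQ_pos hq0 hq1 n
    have : 0 < q^(n+1) := by positivity
    nlinarith
  exact hanti.le_of_tendsto (PQ_tendsto hq0 hq1) n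

lemma invP_bound {q : ℝ} (hq0 : 0 < q) (hq1 : q < 1) (n : ℤ) :
    0 ≤ invP q n ∧ invP q n ≤ (Eu q)⁻¹ := by
  have hE := Eu_pos hq0 hq1
  unfold invP
  split_ifs
  · exact ⟨le_rfl, by positivity⟩
  · have := PQ_pos hq0 hq1 n.toNat
    exact ⟨by positivity, inv_anti₀ hE (Eu_le_PQ hq0 hq1 _)⟩

lemma invP_tendsto {q : ℝ} (hq0 : 0 < q) (hq1 : q < 1) (k : ℤ) :
    Filter.Tendsto (fun N : ℕ => invP q (N + k)) Filter.atTop (nhds (Eu q)⁻¹) := by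
  have h1 : Filter.Tendsto (fun N : ℕ => ((N:ℤ) + k).toNat) Filter.atTop Filter.atTop := by
    apply Filter.tendsto_atTop_atTop.mpr
    intro b
    refine ⟨b + k.natAbs, fun a ha => ?_⟩
    omega
  have h2 := ((PQ_tendsto hq0 hq1).comp h1).inv₀ (Eu_pos hq0 hq1).ne'
  refine h2.congr' ?_
  filter_upwards [Filter.eventually_ge_atTop k.natAbs] with N hN
  have : ¬ ((N:ℤ) + k < 0) := by omega
  simp [invP, this]

theorem jtp {q t : ℝ} (hq0 : 0 < q) (hq1 : q < 1) (ht : t ≠ 0) :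
    th q t = Eu (q^2) * (∏' n : ℕ, (1 + q ^ (2*n+1) * t)) * (∏' n : ℕ, (1 + q ^ (2*n+1) * t⁻¹)) := by
  have hQ0 : 0 < q^2 := by positivity
  have hQ1 : q^2 < 1 := by nlinarith
  have hE := Eu_pos hQ0 hQ1
  have hlim : Filter.Tendsto (fun N : ℕ => ∑' k : ℤ, cJ q N k * t ^ k) Filter.atTop
      (nhds (∑' k : ℤ, (Eu (q^2))⁻¹ * (q^(k^2) * t^k))) := by
    apply tendsto_tsum_of_dominated_convergence
      (bound := fun k : ℤ => (Eu (q^2))⁻¹ * (Eu (q^2))⁻¹ * (q ^ (k^2) * |t| ^ k))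
    · exact (summable_theta hq0 hq1).mul_left _
    · intro k
      have h1 := (PQ_tendsto hQ0 hQ1).comp (Filter.tendsto_atTop_mono (fun n => by omega : ∀ n : ℕ, n ≤ 2*n) Filter.tendsto_id)
      have h2 := invP_tendsto hQ0 hQ1 k
      have h3 := invP_tendsto hQ0 hQ1 (-k)
      have h4 := (((h1.mul h2).mul h3).mul_const (q^(k^2))).mul_const (t^k)
      refine (h4.congr fun N => ?_).trans (le_of_eq ?_)
      · simp [cJ, sub_eq_add_neg]
      · congr 1; field_simp
    · refine Filter.Eventually.of_forall fun N k => ?_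
      have b1 := invP_bound hQ0 hQ1 (N + k)
      have b2 := invP_bound hQ0 hQ1 (N - k)
      have b3 := PQ_pos hQ0 hQ1 (2*N)
      have b4 := PQ_le_one hQ0 hQ1 (2*N)
      have b5 : 0 < q ^ (k^2) := by positivity
      rw [norm_mul, norm_zpow, Real.norm_eq_abs, Real.norm_eq_abs, ← mul_assoc]
      apply mul_le_mul_of_nonneg_right _ (by positivity)
      rw [cJ, abs_of_nonneg (by have := b1.1; have := b2.1; positivity)]
      apply mul_le_mul_of_nonneg_right _ b5.le
      calc _ ≤ 1 * (Eu (q^2))⁻¹ * (Eu (q^2))⁻¹ := by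
            gcongr
            · exact b2.1
            · exact b1.1
            · exact b1.2
            · exact b2.2
        _ = _ := by ring
  have h1 := (mult_one_add hq0 hq1 2 1 two_pos t).hasProd.tendsto_prod_nat
  have h2 := (mult_one_add hq0 hq1 2 1 two_pos t⁻¹).hasProd.tendsto_prod_nat
  have h3 := h1.mul h2
  have h4 := tendsto_nhds_unique hlim (h3.congr fun N => by
    rw [(jtp_finite hq0 hq1 ht N).tsum_eq, prod_mul_distrib])
  rw [tsum_mul_left] at h4
  unfold th
  rw [mul_assoc, ← h4]
  field_simp

end RF

namespace RF

noncomputable def ph (q : ℝ) : ℝ := th q 1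
noncomputable def pm (q : ℝ) : ℝ := th q (-1)
noncomputable def Op (q : ℝ) : ℝ := ∏' n : ℕ, (1 + q ^ (2*n+1))
noncomputable def Om (q : ℝ) : ℝ := ∏' n : ℕ, (1 - q ^ (2*n+1))
noncomputable def Mp (q : ℝ) : ℝ := ∏' n : ℕ, (1 + q ^ (n+1))

section
variable {q : ℝ} (hq0 : 0 < q) (hq1 : q < 1)

lemma sq_lt {q : ℝ} (hq0 : 0 < q) (hq1 : q < 1) : 0 < q^2 ∧ q^2 < 1 := ⟨by positivity, by nlinarith⟩
lemma p4_lt {q : ℝ} (hq0 : 0 < q) (hq1 : q < 1) : 0 < q^4 ∧ q^4 < 1 :=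
  ⟨by positivity, pow_lt_one₀ hq0.le hq1 (by norm_num)⟩

lemma Op_mult {q : ℝ} (hq0 : 0 < q) (hq1 : q < 1) : Multipliable fun n : ℕ => (1 + q ^ (2*n+1)) := by
  refine (mult_one_add hq0 hq1 2 1 two_pos 1).congr fun n => ?_
  ring
lemma Om_mult {q : ℝ} (hq0 : 0 < q) (hq1 : q < 1) : Multipliable fun n : ℕ => (1 - q ^ (2*n+1)) := by
  refine (mult_one_add hq0 hq1 2 1 two_pos (-1)).congr fun n => ?_
  ring
lemma Mp_mult {q : ℝ} (hq0 : 0 < q) (hq1 : q < 1) : Multipliable fun n : ℕ => (1 + q ^ (n+1)) := by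
  refine (mult_one_add hq0 hq1 1 1 one_pos 1).congr fun n => ?_
  ring

lemma Op_Om {q : ℝ} (hq0 : 0 < q) (hq1 : q < 1) : Op q * Om q = Om (q^2) := by
  unfold Op Om
  rw [← (Op_mult hq0 hq1).tprod_mul (Om_mult hq0 hq1)]
  congr 1; ext n; ring

lemma Mp_Eu {q : ℝ} (hq0 : 0 < q) (hq1 : q < 1) : Mp q * Eu q = Eu (q^2) := by
  unfold Mp Eu
  rw [← (Mp_mult hq0 hq1).tprod_mul (Eu_mult hq0 hq1)]
  congr 1; ext n; ring

lemma Om_Eu {q : ℝ} (hq0 : 0 < q) (hq1 : q < 1) : Om q * Eu (q^2) = Eu q := by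
  have h := tprod_even_mul_odd (f := fun n : ℕ => 1 - q^(n+1)) (Om_mult hq0 hq1)
    ((Eu_mult (sq_lt hq0 hq1).1 (sq_lt hq0 hq1).2).congr fun n => by ring)
  rw [← Eu] at h
  rw [← h]
  unfold Om Eu
  congr 2
  ext n; ring

lemma Om_eq {q : ℝ} (hq0 : 0 < q) (hq1 : q < 1) : Om q = Eu q / Eu (q^2) := by
  have := Eu_pos (sq_lt hq0 hq1).1 (sq_lt hq0 hq1).2
  rw [eq_div_iff this.ne', Om_Eu hq0 hq1]

lemma Op_eq {q : ℝ} (hq0 : 0 < q) (hq1 : q < 1) : Op q = Eu (q^2)^2 / (Eu q * Eu (q^4)) := by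
  have h2 := Eu_pos (sq_lt hq0 hq1).1 (sq_lt hq0 hq1).2
  have h1 := Eu_pos hq0 hq1
  have h4 := Eu_pos (p4_lt hq0 hq1).1 (p4_lt hq0 hq1).2
  have := Op_Om hq0 hq1
  rw [Om_eq hq0 hq1, Om_eq (sq_lt hq0 hq1).1 (sq_lt hq0 hq1).2, show (q^2)^2 = q^4 by ring] at this
  field_simp at this ⊢
  linarith

lemma Mp_eq {q : ℝ} (hq0 : 0 < q) (hq1 : q < 1) : Mp q = Eu (q^2) / Eu q := by
  rw [eq_div_iff (Eu_pos hq0 hq1).ne', Mp_Eu hq0 hq1]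

lemma ph_eq {q : ℝ} (hq0 : 0 < q) (hq1 : q < 1) :
    ph q = Eu (q^2)^5 / (Eu q^2 * Eu (q^4)^2) := by
  have h2 := Eu_pos (sq_lt hq0 hq1).1 (sq_lt hq0 hq1).2
  have h1 := Eu_pos hq0 hq1
  have h4 := Eu_pos (p4_lt hq0 hq1).1 (p4_lt hq0 hq1).2
  have : ph q = Eu (q^2) * Op q * Op q := by
    rw [ph, jtp hq0 hq1 one_ne_zero]; simp [Op]
  rw [this, Op_eq hq0 hq1]
  field_simp

lemma pm_eq {q : ℝ} (hq0 : 0 < q) (hq1 : q < 1) :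
    pm q = Eu q^2 / Eu (q^2) := by
  have h2 := Eu_pos (sq_lt hq0 hq1).1 (sq_lt hq0 hq1).2
  have : pm q = Eu (q^2) * Om q * Om q := by
    rw [pm, jtp hq0 hq1 (by norm_num)]; simp [Om, sub_eq_add_neg]
  rw [this, Om_eq hq0 hq1]
  field_simp

lemma psi_eq {q : ℝ} (hq0 : 0 < q) (hq1 : q < 1) :
    th (q^2) q = Eu (q^2)^2 / Eu q := by
  have h2 := Eu_pos (sq_lt hq0 hq1).1 (sq_lt hq0 hq1).2
  have h1 := Eu_pos hq0 hq1
  have h4 := Eu_pos (p4_lt hq0 hq1).1 (p4_lt hq0 hq1).2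
  have h := tprod_even_mul_odd (f := fun n : ℕ => 1 + q^(2*n+1))
    ((mult_one_add hq0 hq1 4 1 (by norm_num) 1).congr fun n => by ring)
    ((mult_one_add hq0 hq1 4 3 (by norm_num) 1).congr fun n => by ring)
  have : th (q^2) q = Eu (q^4) * Op q := by
    rw [jtp (sq_lt hq0 hq1).1 (sq_lt hq0 hq1).2 hq0.ne', Op, ← h, show (q^2)^2 = q^4 by ring, mul_assoc,
      mul_comm (∏' n : ℕ, (1 + q ^ (2 * (2 * n) + 1)))]
    congr 3
    · ext n; ring
    · ext n; field_simp; ring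
  rw [this, Op_eq hq0 hq1]
  field_simp

lemma psim_eq {q : ℝ} (hq0 : 0 < q) (hq1 : q < 1) :
    th (q^2) (-q) = Eu (q^4) * Eu q / Eu (q^2) := by
  have h := tprod_even_mul_odd (f := fun n : ℕ => 1 - q^(2*n+1))
    ((mult_one_add hq0 hq1 4 1 (by norm_num) (-1)).congr fun n => by ring)
    ((mult_one_add hq0 hq1 4 3 (by norm_num) (-1)).congr fun n => by ring)
  have : th (q^2) (-q) = Eu (q^4) * Om q := by
    rw [jtp (sq_lt hq0 hq1).1 (sq_lt hq0 hq1).2 (neg_ne_zero.mpr hq0.ne'), Om, ← h, show (q^2)^2 = q^4 by ring, mul_assoc,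
      mul_comm (∏' n : ℕ, (1 - q ^ (2 * (2 * n) + 1)))]
    congr 3
    · ext n; ring
    · ext n; field_simp; ring
  rw [this, Om_eq hq0 hq1, mul_div_assoc]

lemma B_eq {q : ℝ} (hq0 : 0 < q) (hq1 : q < 1) :
    th (q^2) (q^2) = 2 * Eu (q^8)^2 / Eu (q^4) := by
  have h4 := Eu_pos (p4_lt hq0 hq1).1 (p4_lt hq0 hq1).2
  have hm := Mp_mult (p4_lt hq0 hq1).1 (p4_lt hq0 hq1).2
  have h0 : Multipliable fun n : ℕ => 1 + (q^4)^n := by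
    refine (mult_one_add hq0 hq1 4 0 (by norm_num) 1).congr fun n => by ring
  have : th (q^2) (q^2) = Eu (q^4) * Mp (q^4) * (2 * Mp (q^4)) := by
    rw [jtp (sq_lt hq0 hq1).1 (sq_lt hq0 hq1).2 (sq_lt hq0 hq1).1.ne', show (q^2)^2 = q^4 by ring]
    congr 1
    · congr 1; unfold Mp; congr 1; ext n; ring
    · have e : (fun n : ℕ => 1 + (q^2)^(2*n+1) * (q^2)⁻¹) = fun n => 1 + (q^4)^n := by
        ext n; field_simp; ring
      have h5 := tprod_eq_zero_mul' (f := fun n : ℕ => 1 + (q^4)^n) hm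
      rw [e, h5, pow_zero, Mp]
      norm_num
  rw [this, Mp_eq (p4_lt hq0 hq1).1 (p4_lt hq0 hq1).2, show (q^4)^2 = q^8 by ring]
  field_simp

/-- parity splitting of the lattice -/
def latEquiv : (ℤ × ℤ) ⊕ (ℤ × ℤ) ≃ ℤ × ℤ where
  toFun := Sum.elim (fun p => (p.1 + p.2, p.1 - p.2)) (fun p => (p.1 + p.2 + 1, p.1 - p.2))
  invFun p := if (p.1 + p.2) % 2 = 0 then Sum.inl ((p.1 + p.2)/2, (p.1 - p.2)/2)
    else Sum.inr ((p.1 + p.2 - 1)/2, (p.1 - p.2 - 1)/2)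
  left_inv := by
    rintro (⟨u, v⟩ | ⟨u, v⟩)
    · have : (u + v + (u - v)) % 2 = 0 := by omega
      simp only [Sum.elim_inl, this, if_true]
      congr 2 <;> omega
    · have : ¬ (u + v + 1 + (u - v)) % 2 = 0 := by omega
      simp only [Sum.elim_inr, this, if_false]
      congr 2 <;> omega
  right_inv := by
    rintro ⟨m, n⟩
    dsimp only
    split_ifs with h
    · simp only [Sum.elim_inl]; ext <;> dsimp only <;> omega
    · simp only [Sum.elim_inr]; ext <;> dsimp only <;> omega

lemma hasSum_mul_prod {f g : ℤ → ℝ} {a b : ℝ} (hf : HasSum f a) (hg : HasSum g b) :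
    HasSum (fun p : ℤ × ℤ => f p.1 * g p.2) (a * b) := by
  have hs := summable_mul_of_summable_norm hf.summable.norm hg.summable.norm
  have := hf.mul hg hs
  exact this

lemma th_sq {q : ℝ} (hq0 : 0 < q) (hq1 : q < 1) {ε : ℝ} (hε : ε^2 = 1) :
    th q ε ^ 2 = ph (q^2)^2 + ε * q * th (q^2) (q^2)^2 := by
  have hε0 : ε ≠ 0 := by rintro rfl; norm_num at hε
  have he2 : ∀ k : ℤ, ε ^ (2*k) = 1 := fun k => by rw [zpow_mul]; norm_cast; simp [hε]
  have h1 := hasSum_mul_prod (hasSum_th (t := ε) hq0 hq1) (hasSum_th (t := ε) hq0 hq1)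
  have h1' := latEquiv.hasSum_iff.mpr h1
  obtain ⟨a, b⟩ := sq_lt hq0 hq1
  have h2 := hasSum_mul_prod (hasSum_th (t := 1) a b) (hasSum_th (t := 1) a b)
  have h3 := (hasSum_mul_prod (hasSum_th (t := q^2) a b) (hasSum_th (t := q^2) a b)).mul_left (ε * q)
  have hz : ∀ k : ℤ, (q^2)^k = q^(2*k) := fun k => by rw [zpow_mul]; norm_cast
  have h4 : HasSum (((fun p : ℤ × ℤ => q ^ p.1 ^ 2 * ε ^ p.1 * (q ^ p.2 ^ 2 * ε ^ p.2)) ∘ latEquiv))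
      (th (q^2) 1 * th (q^2) 1 + ε * q * (th (q^2) (q^2) * th (q^2) (q^2))) := by
    apply HasSum.sum
    · refine h2.congr_fun ?_
      rintro ⟨u, v⟩
      simp only [Function.comp, latEquiv, Equiv.coe_fn_mk, Sum.elim_inl, one_zpow, mul_one, hz]
      calc _ = (q ^ (u+v)^2 * q ^ (u-v)^2) * (ε ^ (u+v) * ε^(u-v)) := by ring
        _ = q^(2*u^2) * q^(2*v^2) * 1 := by
          rw [← zpow_add₀ hq0.ne', ← zpow_add₀ hq0.ne', ← zpow_add₀ hε0, ← he2 u]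
          ring_nf
        _ = _ := by ring
    · refine h3.congr_fun ?_
      rintro ⟨u, v⟩
      simp only [Function.comp, latEquiv, Equiv.coe_fn_mk, Sum.elim_inr, hz]
      calc _ = (q ^ (u+v+1)^2 * q ^ (u-v)^2) * (ε ^ (u+v+1) * ε^(u-v)) := by ring
        _ = q^(2*u^2+2*v^2+2*u+2*v+1) * ε := by
          rw [← zpow_add₀ hq0.ne', ← zpow_add₀ hε0]
          congr 1
          · ring_nf
          · rw [show u + v + 1 + (u - v) = 2*u+1 by ring, zpow_add_one₀ hε0, he2]; ring
        _ = _ := by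
          rw [zpow_add_one₀ hq0.ne', zpow_add₀ hq0.ne', zpow_add₀ hq0.ne', zpow_add₀ hq0.ne']
          ring
  have := h1'.unique h4
  rw [ph]
  linarith

/-- evens and odds of the integers -/
lemma hasSum_even_odd {f : ℤ → ℝ} {a b : ℝ} (he : HasSum (fun k => f (2*k)) a)
    (ho : HasSum (fun k => f (2*k+1)) b) : HasSum f (a + b) := by
  have h := HasSum.add_isCompl (s := Set.range fun k : ℤ => 2*k) (t := Set.range fun k : ℤ => 2*k+1) (f := f) ?_
    ((Function.Injective.hasSum_range_iff (fun a b h => by simpa using h)).mpr he)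
    ((Function.Injective.hasSum_range_iff (fun a b h => by simpa using h)).mpr ho)
  · exact h
  · constructor
    · rw [Set.disjoint_left]
      rintro _ ⟨k, rfl⟩ ⟨l, hl⟩
      simp only at hl
      omega
    · rw [codisjoint_iff_le_sup]
      intro n _
      rcases Int.even_or_odd' n with ⟨k, h | h⟩
      · exact Or.inl ⟨k, h.symm⟩
      · exact Or.inr ⟨k, h.symm⟩

lemma ph_add_pm {q : ℝ} (hq0 : 0 < q) (hq1 : q < 1) : ph q + pm q = 2 * ph (q^4) := by
  have h := (hasSum_th (t := 1) hq0 hq1).add (hasSum_th (t := -1) hq0 hq1)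
  obtain ⟨a, b⟩ := p4_lt hq0 hq1
  have h2 := (hasSum_th (t := 1) a b).mul_left 2
  have h3 := hasSum_even_odd (f := fun n : ℤ => q ^ n^2 * 1^n + q^n^2 * (-1)^n) (a := 2 * th (q^4) 1) (b := 0) ?_ ?_
  · have := h.unique h3
    simpa [ph, pm] using this
  · refine h2.congr_fun fun k => ?_
    have : (q^4)^(k^2) = q^((2*k)^2) := by
      rw [show (2*k)^2 = 4 * k^2 by ring, zpow_mul]; norm_cast
    simp only [this, one_zpow, zpow_mul (-1:ℝ)]
    norm_num; ring
  · refine hasSum_zero.congr_fun fun k => ?_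
    rw [zpow_add_one₀ (a := (-1:ℝ)) (by norm_num), zpow_mul (-1:ℝ)]; norm_num

end
end RF

namespace RF

/-- convolution of absolutely convergent bilateral series -/
lemma conv_hasSum {f g : ℤ → ℂ} {a b : ℂ} (hf : Summable fun n => ‖f n‖) (hg : Summable fun n => ‖g n‖)
    (ha : HasSum f a) (hb : HasSum g b) :
    (∀ n, Summable fun m => f m * g (n - m)) ∧ HasSum (fun n => ∑' m, f m * g (n - m)) (a * b) := by
  have hs := summable_mul_of_summable_norm hf hg
  have h := ha.mul hb hs
  let e : ℤ × ℤ ≃ ℤ × ℤ :=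
    { toFun := fun p => (p.2, p.1 - p.2)
      invFun := fun p => (p.1 + p.2, p.1)
      left_inv := fun p => by simp
      right_inv := fun p => by simp }
  have h2 : HasSum (fun p : ℤ × ℤ => f p.2 * g (p.1 - p.2)) (a * b) := e.hasSum_iff.mpr h
  have h3 : ∀ n, Summable fun m => f m * g (n - m) := fun n => h2.summable.prod_factor n
  exact ⟨h3, h2.prod_fiberwise fun n => (h3 n).hasSum⟩

lemma conv_hasSum_real {f g : ℤ → ℝ} {a b : ℝ} (hf : HasSum f a) (hg : HasSum g b) :
    (∀ n, Summable fun m => f m * g (n - m)) ∧ HasSum (fun n => ∑' m, f m * g (n - m)) (a * b) := by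
  have h := hasSum_mul_prod hf hg
  let e : ℤ × ℤ ≃ ℤ × ℤ :=
    { toFun := fun p => (p.2, p.1 - p.2)
      invFun := fun p => (p.1 + p.2, p.1)
      left_inv := fun p => by simp
      right_inv := fun p => by simp }
  have h2 : HasSum (fun p : ℤ × ℤ => f p.2 * g (p.1 - p.2)) (a * b) := e.hasSum_iff.mpr h
  have h3 : ∀ n, Summable fun m => f m * g (n - m) := fun n => h2.summable.prod_factor n
  exact ⟨h3, h2.prod_fiberwise fun n => (h3 n).hasSum⟩

noncomputable def sc (Q : ℝ) (n : ℤ) : ℝ := 2 / (Q ^ n + Q ^ (-n))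

section
variable {Q : ℝ}

lemma sc_pos (hQ0 : 0 < Q) (n : ℤ) : 0 < sc Q n := by unfold sc; positivity

lemma sc_le_one (hQ0 : 0 < Q) (n : ℤ) : sc Q n ≤ 1 := by
  unfold sc
  rw [div_le_one (by positivity), zpow_neg]
  have : 0 < Q^n := by positivity
  have h : Q^n * (Q^n)⁻¹ = 1 := by field_simp
  have : 0 < (Q^n)⁻¹ := by positivity
  nlinarith [sq_nonneg (Q^n - (Q^n)⁻¹)]

lemma sc_neg (n : ℤ) : sc Q (-n) = sc Q n := by unfold sc; rw [neg_neg, add_comm]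

lemma sc_le (hQ0 : 0 < Q) (n : ℤ) : sc Q n ≤ 2 * Q ^ n.natAbs := by
  have key : ∀ k : ℕ, sc Q k ≤ 2 * Q ^ k := by
    intro k
    unfold sc
    rw [div_le_iff₀ (by positivity), zpow_neg, zpow_natCast]
    have : 0 < Q^k := by positivity
    have h : Q^k * (Q^k)⁻¹ = 1 := by field_simp
    nlinarith [sq_nonneg (Q^k)]
  obtain ⟨k, rfl | rfl⟩ := n.eq_nat_or_neg
  · simpa using key k
  · rw [sc_neg, Int.natAbs_neg]; simpa using key k

lemma sc_two_mul (n : ℤ) : sc Q (2*n) = sc (Q^2) n := by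
  unfold sc
  rw [show -(2*n) = 2 * (-n) by ring, zpow_mul, zpow_mul]; norm_cast

lemma summable_natAbs_geom {r : ℝ} (hr0 : 0 ≤ r) (hr1 : r < 1) (k : ℕ) :
    Summable fun n : ℤ => (n.natAbs : ℝ)^k * r ^ n.natAbs := by
  have h := summable_pow_mul_geometric_of_norm_lt_one (R := ℝ) k (r := r) (by rwa [Real.norm_of_nonneg hr0])
  apply Summable.of_nat_of_neg <;> simpa using h

lemma summable_sc_pow (hQ0 : 0 < Q) {t : ℝ} (ht0 : t ≠ 0) (ht1 : Q < |t|) (ht2 : |t| * Q < 1) :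
    Summable fun n : ℤ => sc Q n * t ^ n := by
  have ht : 0 < |t| := abs_pos.mpr ht0
  apply Summable.of_nat_of_neg
  · have h := (summable_geometric_of_lt_one (r := |t| * Q) (by positivity) ht2).mul_left 2
    refine Summable.of_norm_bounded h fun n => ?_
    rw [norm_mul, norm_zpow, Real.norm_of_nonneg (sc_pos hQ0 _).le, Real.norm_eq_abs, mul_pow, zpow_natCast]
    have := sc_le hQ0 (n:ℤ)
    simp only [Int.natAbs_natCast] at this
    have h3 : 0 < |t|^n := by positivity
    nlinarith
  · have h := (summable_geometric_of_lt_one (r := |t|⁻¹ * Q) (by positivity) (by field_simp; exact ht1)).mul_left 2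
    refine Summable.of_norm_bounded h fun n => ?_
    rw [sc_neg, norm_mul, norm_zpow, Real.norm_of_nonneg (sc_pos hQ0 _).le, Real.norm_eq_abs, mul_pow, zpow_neg,
      zpow_natCast, inv_pow]
    have := sc_le hQ0 (n:ℤ)
    simp only [Int.natAbs_natCast] at this
    have h3 : 0 < (|t|^n)⁻¹ := by positivity
    nlinarith

noncomputable def LD (Q t : ℝ) : ℝ := ∑' n : ℤ, sc Q n * t ^ n

noncomputable def ee (Q : ℝ) (n : ℤ) : ℝ := ∑' m : ℤ, (-1)^m * sc Q m * Q ^ (m^2 - 2*n*m)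

lemma ee_summable (hQ0 : 0 < Q) (hQ1 : Q < 1) (n : ℤ) :
    Summable fun m : ℤ => (-1)^m * sc Q m * Q ^ (m^2 - 2*n*m) := by
  refine Summable.of_norm_bounded (summable_theta (t := Q^(-2*n)) hQ0 hQ1) fun m => ?_
  rw [norm_mul, norm_mul, norm_zpow, norm_neg, norm_one, one_zpow, one_mul, Real.norm_of_nonneg (sc_pos hQ0 _).le,
    Real.norm_of_nonneg (by positivity), ← zpow_mul, ← zpow_add₀ hQ0.ne', show m^2 + -2*n*m = m^2 - 2*n*m by ring]
  have : 0 < Q ^ (m^2 - 2*n*m) := by positivity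
  have := sc_le_one hQ0 m
  nlinarith

lemma ee_rec (hQ0 : 0 < Q) (hQ1 : Q < 1) (n : ℤ) : ee Q n = - ee Q (n-1) := by
  have h := (ee_summable hQ0 hQ1 n).hasSum.add (ee_summable hQ0 hQ1 (n-1)).hasSum
  have h2 : HasSum (fun m : ℤ => (-1:ℝ)^m * 2 * Q ^ (m^2 - (2*n-1)*m)) (ee Q n + ee Q (n-1)) := by
    refine h.congr_fun fun m => ?_
    have e1 : Q ^ (m^2 - 2*n*m) = Q ^ (m^2 - (2*n-1)*m) * Q^(-m) := by
      rw [← zpow_add₀ hQ0.ne']; ring_nf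
    have e2 : Q ^ (m^2 - 2*(n-1)*m) = Q ^ (m^2 - (2*n-1)*m) * Q^m := by
      rw [← zpow_add₀ hQ0.ne']; ring_nf
    rw [e1, e2]
    have : sc Q m * (Q^m + Q^(-m)) = 2 := by
      unfold sc; have : 0 < Q^m + Q^(-m) := by positivity
      field_simp
    linear_combination (-(-1)^m * Q ^ (m^2 - (2*n-1)*m)) * this
  have h3 := (Equiv.subLeft (2*n-1)).hasSum_iff.mpr h2
  have h4 : HasSum (fun m : ℤ => (-1:ℝ)^m * 2 * Q ^ (m^2 - (2*n-1)*m)) (-(ee Q n + ee Q (n-1))) := by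
    refine h3.neg.congr_fun fun m => ?_
    simp only [Function.comp, Equiv.subLeft_apply]
    have e1 : (-1:ℝ)^(2*n-1-m) = -(-1)^m := by
      rw [zpow_sub₀ (by norm_num), zpow_sub₀ (by norm_num), zpow_mul]
      have : ((-1:ℝ)^m) * ((-1)^m) = 1 := by rw [← mul_zpow]; norm_num
      have h0 : ((-1:ℝ)^m) ≠ 0 := by positivity
      norm_num
      field_simp
      linarith
    rw [e1]
    ring_nf
  have := h2.unique h4
  linarith

lemma ee_eq (hQ0 : 0 < Q) (hQ1 : Q < 1) (n : ℤ) : ee Q n = (-1)^n * ee Q 0 := by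
  induction n using Int.induction_on with
  | zero => simp
  | succ i ih =>
    rw [ee_rec hQ0 hQ1, add_sub_cancel_right, ih, zpow_add_one₀ (by norm_num)]; ring
  | pred i ih =>
    have := ee_rec hQ0 hQ1 (-(i:ℤ))
    rw [ih] at this
    rw [zpow_sub_one₀ (by norm_num), show ((-1:ℝ))⁻¹ = -1 by norm_num]
    linarith

lemma LD_th (hQ0 : 0 < Q) (hQ1 : Q < 1) {t : ℝ} (ht0 : t ≠ 0) (ht1 : Q < |t|) (ht2 : |t| * Q < 1) :
    LD Q t * th Q (-t) = ee Q 0 * th Q t := by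
  have h1 := (summable_sc_pow hQ0 ht0 ht1 ht2).hasSum
  have h2 := hasSum_th (t := -t) hQ0 hQ1
  have h3 := (conv_hasSum_real h1 h2).2
  have h4 := (hasSum_th (t := t) hQ0 hQ1).mul_left (ee Q 0)
  refine h3.unique (h4.congr_fun fun n => ?_)
  have : ∀ m : ℤ, sc Q m * t^m * (Q^((n-m)^2) * (-t)^(n-m)) =
      ((-1)^n * Q^(n^2) * t^n) * ((-1)^m * sc Q m * Q ^ (m^2 - 2*n*m)) := by
    intro m
    rw [show (n-m)^2 = n^2 + (m^2 - 2*n*m) by ring, zpow_add₀ hQ0.ne', neg_eq_neg_one_mul, mul_zpow,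
      zpow_sub₀ ht0, zpow_sub₀ (by norm_num : (-1:ℝ) ≠ 0)]
    have : ((-1:ℝ)^m) * ((-1)^m) = 1 := by rw [← mul_zpow]; norm_num
    have h0 : ((-1:ℝ)^m) ≠ 0 := by positivity
    field_simp
    linear_combination (- sc Q m) * this
  simp_rw [this]
  rw [tsum_mul_left, ← ee, ee_eq hQ0 hQ1]
  have : ((-1:ℝ)^n) * ((-1)^n) = 1 := by rw [← mul_zpow]; norm_num
  linear_combination (Q^(n^2)*t^n * ee Q 0) * this

lemma pm_pos (hQ0 : 0 < Q) (hQ1 : Q < 1) : 0 < pm Q := by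
  rw [pm_eq hQ0 hQ1]
  have h2 := Eu_pos (sq_lt hQ0 hQ1).1 (sq_lt hQ0 hQ1).2
  have h1 := Eu_pos hQ0 hQ1
  positivity

lemma ph_pos (hQ0 : 0 < Q) (hQ1 : Q < 1) : 0 < ph Q := by
  rw [ph_eq hQ0 hQ1]
  have h2 := Eu_pos (sq_lt hQ0 hQ1).1 (sq_lt hQ0 hQ1).2
  have h4 := Eu_pos (p4_lt hQ0 hQ1).1 (p4_lt hQ0 hQ1).2
  have h1 := Eu_pos hQ0 hQ1
  positivity

noncomputable def lam (Q : ℝ) : ℝ := ee Q 0 / (ph Q * pm Q)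

lemma LD_one (hQ0 : 0 < Q) (hQ1 : Q < 1) : LD Q 1 = lam Q * ph Q^2 := by
  have h := LD_th hQ0 hQ1 (t := 1) one_ne_zero (by simpa) (by simpa)
  rw [← ph, ← pm] at h
  have := pm_pos hQ0 hQ1
  have := ph_pos hQ0 hQ1
  unfold lam
  field_simp
  exact h

lemma LD_neg_one (hQ0 : 0 < Q) (hQ1 : Q < 1) : LD Q (-1) = lam Q * pm Q^2 := by
  have h := LD_th hQ0 hQ1 (t := -1) (by norm_num) (by simpa) (by simpa)
  rw [neg_neg, ← ph, ← pm] at h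
  have := pm_pos hQ0 hQ1
  have := ph_pos hQ0 hQ1
  unfold lam
  field_simp
  exact h

lemma LD_add (hQ0 : 0 < Q) (hQ1 : Q < 1) : LD Q 1 + LD Q (-1) = 2 * LD (Q^2) 1 := by
  have h := (summable_sc_pow hQ0 (t := 1) one_ne_zero (by simpa) (by simpa)).hasSum.add
    (summable_sc_pow hQ0 (t := -1) (by norm_num) (by simpa) (by simpa)).hasSum
  obtain ⟨a, b⟩ := sq_lt hQ0 hQ1
  have h2 := (summable_sc_pow a (t := 1) one_ne_zero (by simpa only [abs_one] using b) (by simpa only [abs_one, one_mul] using b)).hasSum.mul_left 2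
  have h3 := hasSum_even_odd (f := fun n : ℤ => sc Q n * 1^n + sc Q n * (-1)^n) (a := 2 * LD (Q^2) 1) (b := 0) ?_ ?_
  · have := h.unique h3
    simpa [LD] using this
  · refine h2.congr_fun fun k => ?_
    simp only [sc_two_mul, one_zpow, zpow_mul (-1:ℝ)]
    norm_num; ring
  · refine hasSum_zero.congr_fun fun k => ?_
    rw [zpow_add_one₀ (a := (-1:ℝ)) (by norm_num), zpow_mul (-1:ℝ)]; norm_num

lemma ph_sq_add (hQ0 : 0 < Q) (hQ1 : Q < 1) : ph Q^2 + pm Q^2 = 2 * ph (Q^2)^2 := by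
  have h1 := th_sq hQ0 hQ1 (ε := 1) (by norm_num)
  have h2 := th_sq hQ0 hQ1 (ε := -1) (by norm_num)
  rw [← ph] at h1
  rw [← pm] at h2
  linarith

lemma lam_sq (hQ0 : 0 < Q) (hQ1 : Q < 1) : lam Q = lam (Q^2) := by
  obtain ⟨a, b⟩ := sq_lt hQ0 hQ1
  have h := LD_add hQ0 hQ1
  rw [LD_one hQ0 hQ1, LD_neg_one hQ0 hQ1, LD_one a b, ← mul_add, ph_sq_add hQ0 hQ1] at h
  have := ph_pos a b
  have h2 : (lam Q - lam (Q^2)) * (2 * ph (Q^2)^2) = 0 := by linarith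
  rcases mul_eq_zero.mp h2 with h3 | h3
  · linarith
  · have : 0 < 2 * ph (Q^2)^2 := by positivity
    linarith

lemma lam_iter (hQ0 : 0 < Q) (hQ1 : Q < 1) (k : ℕ) : lam (Q^(2^k)) = lam Q := by
  induction k with
  | zero => simp
  | succ k ih =>
    rw [← ih, lam_sq (Q := Q^(2^k)) (by positivity) (pow_lt_one₀ hQ0.le hQ1 (by positivity)), ← pow_mul, ← pow_succ]

lemma seq_tendsto (hQ0 : 0 < Q) (hQ1 : Q < 1) :
    Filter.Tendsto (fun k : ℕ => Q^(2^k)) Filter.atTop (nhds 0) :=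
  (tendsto_pow_atTop_nhds_zero_of_lt_one hQ0.le hQ1).comp
    (tendsto_pow_atTop_atTop_of_one_lt (by norm_num : (1:ℕ) < 2))

lemma dom_aux {F : ℝ → ℤ → ℝ} (hQ0 : 0 < Q) (hQ1 : Q < 1)
    (h0 : ∀ x, 0 < x → x < 1 → F x 0 = 1) (hF : ∀ x n, 0 < x → x < 1 → |F x n| ≤ 2 * x ^ n.natAbs) :
    Filter.Tendsto (fun k : ℕ => ∑' n : ℤ, F (Q^(2^k)) n) Filter.atTop (nhds 1) := by
  have hx : ∀ k : ℕ, 0 < Q^(2^k) ∧ Q^(2^k) < 1 := fun k =>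
    ⟨by positivity, pow_lt_one₀ hQ0.le hQ1 (by positivity)⟩
  have h := tendsto_tsum_of_dominated_convergence (f := fun (k : ℕ) (n : ℤ) => F (Q^(2^k)) n) (𝓕 := Filter.atTop)
    (g := fun n : ℤ => if n = 0 then (1:ℝ) else 0) (bound := fun n => 2 * Q ^ n.natAbs) ?_ ?_ ?_
  · simpa using h
  · have := (summable_natAbs_geom hQ0.le hQ1 0).mul_left 2
    simpa using this
  · intro n
    by_cases hn : n = 0
    · subst hn
      simp only [if_true]
      refine tendsto_const_nhds.congr fun k => (h0 _ (hx k).1 (hx k).2).symm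
    · simp only [hn, if_false]
      have h1 : Filter.Tendsto (fun k : ℕ => 2 * (Q^(2^k)) ^ n.natAbs) Filter.atTop (nhds 0) := by
        have := ((seq_tendsto hQ0 hQ1).pow n.natAbs).const_mul 2
        simpa [hn] using this
      exact squeeze_zero_norm (fun k => hF _ n (hx k).1 (hx k).2) h1
  · refine Filter.Eventually.of_forall fun k n => (hF _ n (hx k).1 (hx k).2).trans ?_
    gcongr
    exact pow_le_of_le_one hQ0.le hQ1.le (by positivity)

lemma lam_one (hQ0 : 0 < Q) (hQ1 : Q < 1) : lam Q = 1 := by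
  have h1 : Filter.Tendsto (fun k : ℕ => LD (Q^(2^k)) 1) Filter.atTop (nhds 1) := by
    apply dom_aux (F := fun x n => sc x n * 1 ^ n) hQ0 hQ1
    · intro x hx _; simp [sc]; norm_num
    · intro x n hx _
      rw [one_zpow, mul_one, abs_of_pos (sc_pos hx n)]
      exact sc_le hx n
  have h2 : Filter.Tendsto (fun k : ℕ => ph (Q^(2^k))) Filter.atTop (nhds 1) := by
    apply dom_aux (F := fun x n => x ^ (n^2) * 1 ^ n) hQ0 hQ1
    · intro x hx _; simp
    · intro x n hx hx1
      rw [one_zpow, mul_one, abs_of_pos (by positivity), ← Int.natAbs_sq, ← Nat.cast_pow, zpow_natCast]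
      have h3 : x ^ (n.natAbs^2) ≤ x ^ n.natAbs := pow_le_pow_of_le_one hx.le hx1.le (by nlinarith)
      have : 0 < x ^ n.natAbs := by positivity
      linarith
  have h3 := h1.div (h2.pow 2) (by norm_num)
  have h4 : Filter.Tendsto (fun _ : ℕ => lam Q) Filter.atTop (nhds (1/1^2)) := by
    refine h3.congr fun k => ?_
    have hx : 0 < Q^(2^k) ∧ Q^(2^k) < 1 := ⟨by positivity, pow_lt_one₀ hQ0.le hQ1 (by positivity)⟩
    simp only [Pi.div_apply]
    rw [LD_one hx.1 hx.2, lam_iter hQ0 hQ1]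
    have := ph_pos hx.1 hx.2
    field_simp
  have := tendsto_nhds_unique h4 tendsto_const_nhds
  rw [← this]; norm_num

lemma LD_half {q : ℝ} (hq0 : 0 < q) (hq1 : q < 1) : LD (q^2) q = ph q * ph (q^2) := by
  obtain ⟨a, b⟩ := sq_lt hq0 hq1
  obtain ⟨c, d⟩ := p4_lt hq0 hq1
  have h := LD_th a b (t := q) hq0.ne' (by rw [abs_of_pos hq0]; nlinarith)
    (by rw [abs_of_pos hq0]; nlinarith)
  have hl := lam_one a b
  have h2 := pm_pos a b
  have h3 := ph_pos a b
  unfold lam at hl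
  rw [div_eq_one_iff_eq (by positivity)] at hl
  rw [hl, psi_eq hq0 hq1, psim_eq hq0 hq1, pm_eq a b, show (q^2)^2 = q^4 by ring] at h
  rw [ph_eq hq0 hq1]
  have e1 := Eu_pos hq0 hq1
  have e2 := Eu_pos a b
  have e4 := Eu_pos c d
  field_simp at h ⊢
  linarith

end
end RF

namespace RF

lemma hs_congr {ι M : Type*} [AddCommMonoid M] [TopologicalSpace M] {f g : ι → M} {a b : M} (h : HasSum f a)
    (hfg : ∀ x, g x = f x) (hab : b = a) : HasSum g b := by
  rw [hab, funext hfg]; exact h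

noncomputable def hh (Q : ℝ) (n : ℤ) : ℝ := (1 - Q^(2*n)) / (1 + Q^(2*n))
noncomputable def ct (Q : ℝ) (n : ℤ) : ℝ := (1 + Q^(2*n)) / (1 - Q^(2*n))
noncomputable def gg (Q : ℝ) (n : ℤ) : ℝ := hh Q (n+1) - hh Q n

section
variable {Q : ℝ}

lemma hh_neg (hQ0 : 0 < Q) (n : ℤ) : hh Q (-n) = - hh Q n := by
  unfold hh
  rw [show 2 * -n = -(2*n) by ring, zpow_neg]
  have : 0 < Q^(2*n) := by positivity
  field_simp
  ring

lemma hh_zero : hh Q 0 = 0 := by simp [hh]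

lemma gg_symm (hQ0 : 0 < Q) (n : ℤ) : gg Q (-1 - n) = gg Q n := by
  unfold gg
  rw [show -1 - n + 1 = -n by ring, show -1 - n = -(n+1) by ring, hh_neg hQ0, hh_neg hQ0]; ring

lemma gg_bound (hQ0 : 0 < Q) (hQ1 : Q < 1) (n : ℕ) : 0 ≤ gg Q n ∧ gg Q n ≤ 2 * (Q^2)^n := by
  have e : gg Q n = 2 * (Q^2)^n * (1 - Q^2) / ((1 + (Q^2)^n * Q^2) * (1 + (Q^2)^n)) := by
    unfold gg hh
    rw [show 2 * ((n:ℤ)+1) = ((2*n+2 : ℕ) : ℤ) by push_cast; ring, show 2 * (n:ℤ) = ((2*n : ℕ) : ℤ) by push_cast; ring,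
      zpow_natCast, zpow_natCast, pow_add, pow_mul]
    have : 0 < (Q^2)^n := by positivity
    field_simp
    ring
  obtain ⟨a, b⟩ := sq_lt hQ0 hQ1
  have h : 0 < (Q^2)^n := by positivity
  have h1 : 0 < 1 - Q^2 := by linarith
  rw [e]
  refine ⟨by positivity, ?_⟩
  rw [div_le_iff₀ (by positivity)]
  have h2 : 1 - Q^2 ≤ 1 := by linarith
  have h3 : 1 ≤ (1 + (Q^2)^n * Q^2) * (1 + (Q^2)^n) := by
    have : 0 < (Q^2)^n * Q^2 := by positivity
    nlinarith
  have h4 : 1 - Q^2 ≤ (1 + (Q^2)^n * Q^2) * (1 + (Q^2)^n) := h2.trans h3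
  exact mul_le_mul_of_nonneg_left h4 (by positivity)

lemma gg_hasSum_nat (hQ0 : 0 < Q) (hQ1 : Q < 1) : HasSum (fun n : ℕ => gg Q n) 1 := by
  rw [hasSum_iff_tendsto_nat_of_nonneg (fun n => (gg_bound hQ0 hQ1 n).1)]
  have h : ∀ N : ℕ, ∑ i ∈ range N, gg Q i = (1 - (Q^2)^N)/(1 + (Q^2)^N) := by
    intro N
    have := Finset.sum_range_sub (fun i : ℕ => hh Q i) N
    simp only [Nat.cast_add, Nat.cast_one, Nat.cast_zero, hh_zero, sub_zero] at this
    unfold gg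
    rw [this, hh, zpow_mul, zpow_natCast]; norm_cast
  simp_rw [h]
  obtain ⟨a, b⟩ := sq_lt hQ0 hQ1
  have h2 := tendsto_pow_atTop_nhds_zero_of_lt_one a.le b
  have h3 := (h2.const_sub 1).div (h2.const_add 1) (by norm_num)
  rw [sub_zero, add_zero, div_one] at h3
  exact h3

lemma gg_neg_nat (hQ0 : 0 < Q) (n : ℕ) : gg Q (-((n:ℤ)+1)) = gg Q n := by
  rw [← gg_symm hQ0 n]; congr 1; ring

lemma gg_hasSum (hQ0 : 0 < Q) (hQ1 : Q < 1) : HasSum (gg Q) 2 := by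
  have h := gg_hasSum_nat hQ0 hQ1
  have h2 : HasSum (fun n : ℕ => gg Q (-((n:ℤ)+1))) 1 := h.congr_fun fun n => (gg_neg_nat hQ0 n)
  have := HasSum.of_nat_of_neg_add_one h h2
  norm_num at this
  exact this

lemma jgg_hasSum (hQ0 : 0 < Q) (hQ1 : Q < 1) : HasSum (fun j : ℤ => (j:ℝ) * gg Q j) (-1) := by
  obtain ⟨a, b⟩ := sq_lt hQ0 hQ1
  have s1 : Summable fun n : ℕ => (n:ℝ) * gg Q n := by
    have h := (summable_pow_mul_geometric_of_norm_lt_one (R := ℝ) 1 (r := Q^2) (by rwa [Real.norm_of_nonneg a.le])).mul_left 2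
    refine Summable.of_norm_bounded h fun n => ?_
    rw [norm_mul, Real.norm_of_nonneg (gg_bound hQ0 hQ1 n).1, Real.norm_of_nonneg (by positivity)]
    have := (gg_bound hQ0 hQ1 n).2
    have hn : (0:ℝ) ≤ n := by positivity
    nlinarith
  have s2 : Summable fun j : ℤ => (j:ℝ) * gg Q j := by
    apply Summable.of_nat_of_neg_add_one
    · simpa using s1
    · refine (s1.add (gg_hasSum_nat hQ0 hQ1).summable).neg.congr fun n => ?_
      rw [gg_neg_nat hQ0]; push_cast; ring
  have h := s2.hasSum
  have h2 := (Equiv.subLeft (-1 : ℤ)).hasSum_iff.mpr h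
  have h3 := ((gg_hasSum hQ0 hQ1).neg.sub h).congr_fun (g := (fun j : ℤ => (j:ℝ) * gg Q j) ∘ Equiv.subLeft (-1 : ℤ)) fun j => by
    simp only [Function.comp, Equiv.subLeft_apply, gg_symm hQ0]; push_cast; ring
  have := h2.unique h3
  rw [show (∑' j : ℤ, (j:ℝ) * gg Q j) = -1 by linarith] at h
  exact h

lemma T_hasSum (hQ0 : 0 < Q) (hQ1 : Q < 1) (n : ℤ) : HasSum (fun m : ℤ => hh Q m + hh Q (n - m)) (2 * n) := by
  have step : ∀ n : ℤ, HasSum (fun m : ℤ => hh Q (n + 1 - m) - hh Q (n - m)) 2 := by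
    intro n
    have := (Equiv.subLeft n).hasSum_iff.mpr (gg_hasSum hQ0 hQ1)
    refine this.congr_fun fun m => ?_
    simp only [Function.comp, Equiv.subLeft_apply, gg]
    ring_nf
  induction n using Int.induction_on with
  | zero =>
    refine hs_congr hasSum_zero (fun m => ?_) ?_
    · rw [zero_sub, hh_neg hQ0]; ring
    · simp
  | succ i ih =>
    refine hs_congr (ih.add (step i)) (fun m => ?_) ?_
    · ring
    · push_cast; ring
  | pred i ih =>
    have := step (-(i:ℤ) - 1)
    refine hs_congr (ih.sub this) (fun m => ?_) ?_
    · ring_nf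
    · push_cast; ring

lemma R_hasSum (hQ0 : 0 < Q) (hQ1 : Q < 1) {R : ℝ} (h0 : HasSum (fun m : ℤ => (m:ℝ) * (ct Q m + hh Q (0 - m))) R)
    (n : ℤ) : HasSum (fun m : ℤ => (m:ℝ) * (ct Q m + hh Q (n - m))) (R + n^2) := by
  have step : ∀ n : ℤ, HasSum (fun m : ℤ => (m:ℝ) * (hh Q (n + 1 - m) - hh Q (n - m))) (2*n+1) := by
    intro n
    have := (Equiv.subLeft n).hasSum_iff.mpr (((gg_hasSum hQ0 hQ1).mul_left (n:ℝ)).sub (jgg_hasSum hQ0 hQ1))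
    refine hs_congr this (fun m => ?_) ?_
    · simp only [Function.comp, Equiv.subLeft_apply, gg]
      push_cast
      ring_nf
    · ring
  induction n using Int.induction_on with
  | zero =>
    refine hs_congr h0 (fun m => rfl) ?_
    simp
  | succ i ih =>
    refine hs_congr (ih.add (step i)) (fun m => ?_) ?_
    · ring
    · push_cast; ring
  | pred i ih =>
    have := step (-(i:ℤ) - 1)
    refine hs_congr (ih.sub this) (fun m => ?_) ?_
    · ring_nf
    · push_cast; ring

noncomputable def pp (Q : ℝ) (n : ℤ) : ℝ := ∑' m : ℤ, sc Q m * sc Q (n - m)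

lemma zpow_two_ne (hQ0 : 0 < Q) (hQ1 : Q < 1) {n : ℤ} (hn : n ≠ 0) : (Q^n)^2 ≠ 1 := by
  intro h
  have h1 : Q^n = 1 := by
    have : 0 < Q^n := by positivity
    nlinarith
  rw [zpow_eq_one_iff_right₀ hQ0.le hQ1.ne] at h1
  exact hn h1

lemma pp_eq (hQ0 : 0 < Q) (hQ1 : Q < 1) {n : ℤ} (hn : n ≠ 0) :
    pp Q n = 4 * n * Q^n / (1 - (Q^n)^2) := by
  have h := (T_hasSum hQ0 hQ1 n).mul_left (2 * Q^n / (1 - (Q^n)^2))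
  have h1 := zpow_two_ne hQ0 hQ1 hn
  have h1 : 1 - (Q^n)^2 ≠ 0 := sub_ne_zero.mpr h1.symm
  unfold pp
  refine HasSum.tsum_eq (hs_congr h (fun m => ?_) (by ring))
  unfold sc hh
  rw [mul_comm 2 m, mul_comm 2 (n-m), zpow_mul, zpow_mul, zpow_neg, zpow_neg, zpow_sub₀ hQ0.ne']
  have hu : 0 < Q^m := by positivity
  have hv : 0 < Q^n := by positivity
  norm_cast
  generalize Q^m = u at *
  generalize Q^n = v at *
  field_simp
  ring

lemma pp_sc (hQ0 : 0 < Q) (hQ1 : Q < 1) (m n : ℤ) :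
    pp Q m * sc Q (n - m) = 2 * sc Q n * ((m:ℝ) * (ct Q m + hh Q (n - m))) + if m = 0 then pp Q 0 * sc Q n else 0 := by
  by_cases hm : m = 0
  · subst hm; simp
  rw [if_neg hm, pp_eq hQ0 hQ1 hm]
  have h1 := zpow_two_ne hQ0 hQ1 hm
  have h1 : 1 - (Q^m)^2 ≠ 0 := sub_ne_zero.mpr h1.symm
  unfold sc hh ct
  rw [mul_comm 2 m, mul_comm 2 (n-m), zpow_mul, zpow_mul, zpow_neg, zpow_neg, zpow_sub₀ hQ0.ne']
  have hu : 0 < Q^m := by positivity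
  have hv : 0 < Q^n := by positivity
  norm_cast
  generalize Q^m = u at *
  generalize Q^n = v at *
  have : 1 + v^2 ≠ 0 := by positivity
  have : u^2 + v^2 ≠ 0 := by positivity
  push_cast
  field_simp
  ring

lemma sc_summable (hQ0 : 0 < Q) (hQ1 : Q < 1) : Summable (sc Q) := by
  simpa using summable_sc_pow hQ0 (t := 1) one_ne_zero (by simpa) (by simpa)

lemma ppsc_hasSum (hQ0 : 0 < Q) (hQ1 : Q < 1) : ∃ C : ℝ, ∀ n : ℤ,
    HasSum (fun m => pp Q m * sc Q (n - m)) ((C + 2 * n^2) * sc Q n) := by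
  have hs := sc_summable hQ0 hQ1
  have hp := (conv_hasSum_real hs.hasSum hs.hasSum).2
  have h := (conv_hasSum_real hp hs.hasSum).1 0
  have hi : Summable fun m : ℤ => if m = 0 then pp Q 0 * sc Q 0 else 0 := (hasSum_ite_eq 0 _).summable
  have h2 : Summable fun m : ℤ => (m:ℝ) * (ct Q m + hh Q (0 - m)) := by
    refine ((h.sub hi).mul_left (1/2)).congr fun m => ?_
    rw [← pp, pp_sc hQ0 hQ1, show sc Q 0 = 1 by simp [sc]; norm_num]
    ring
  refine ⟨pp Q 0 + 2 * ∑' m : ℤ, (m:ℝ) * (ct Q m + hh Q (0 - m)), fun n => ?_⟩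
  have h3 := ((R_hasSum hQ0 hQ1 h2.hasSum n).mul_left (2 * sc Q n)).add (hasSum_ite_eq (0:ℤ) (pp Q 0 * sc Q n))
  refine hs_congr h3 (fun m => ?_) (by ring)
  rw [pp_sc hQ0 hQ1]

/-! ### the function D -/

noncomputable def tm (Q : ℝ) (k : ℕ) (w : ℂ) (n : ℤ) : ℂ := (n:ℂ)^k * (sc Q n : ℂ) * Complex.exp (n * w)
noncomputable def DD (Q : ℝ) (k : ℕ) (w : ℂ) : ℂ := ∑' n : ℤ, tm Q k w n

lemma tm_bound (hQ0 : 0 < Q) {b : ℝ} (k : ℕ) (n : ℤ) {w : ℂ} (hw : |w.re| ≤ b) :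
    ‖tm Q k w n‖ ≤ 2 * ((n.natAbs:ℝ)^k * (Real.exp b * Q) ^ n.natAbs) := by
  unfold tm
  rw [norm_mul, norm_mul, norm_pow, Complex.norm_exp, Complex.norm_real, Real.norm_of_nonneg (sc_pos hQ0 n).le]
  have e1 : ‖(n:ℂ)‖ = (n.natAbs:ℝ) := by
    rw [Complex.norm_intCast, Nat.cast_natAbs, Int.cast_abs]
  rw [e1]
  have h1 := sc_le hQ0 n
  have h2 : Real.exp ((n:ℂ) * w).re ≤ Real.exp b ^ n.natAbs := by
    rw [← Real.exp_nat_mul]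
    apply Real.exp_le_exp.mpr
    have : ((n:ℂ) * w).re = n * w.re := by simp
    rw [this, Nat.cast_natAbs, Int.cast_abs]
    calc (n:ℝ) * w.re ≤ |(n:ℝ) * w.re| := le_abs_self _
      _ = |(n:ℝ)| * |w.re| := abs_mul _ _
      _ ≤ _ := by gcongr
  calc (n.natAbs:ℝ)^k * sc Q n * Real.exp ((n:ℂ) * w).re 
      ≤ (n.natAbs:ℝ)^k * (2 * Q ^ n.natAbs) * Real.exp b ^ n.natAbs := by gcongr
    _ = _ := by rw [mul_pow]; ring

lemma tm_summable (hQ0 : 0 < Q) {b : ℝ} (hb : Real.exp b * Q < 1) (k : ℕ) {w : ℂ} (hw : |w.re| ≤ b) :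
    Summable fun n => ‖tm Q k w n‖ :=
  Summable.of_nonneg_of_le (fun _ => norm_nonneg _) (fun n => tm_bound hQ0 k n hw)
    ((summable_natAbs_geom (by positivity) hb k).mul_left 2)

lemma DD_hasSum (hQ0 : 0 < Q) {b : ℝ} (hb : Real.exp b * Q < 1) (k : ℕ) {w : ℂ} (hw : |w.re| ≤ b) :
    HasSum (tm Q k w) (DD Q k w) := (tm_summable hQ0 hb k hw).of_norm.hasSum

def strip (b : ℝ) : Set ℂ := {w | |w.re| < b}

lemma strip_open (b : ℝ) : IsOpen (strip b) :=
  isOpen_lt (continuous_abs.comp Complex.continuous_re) continuous_const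

lemma strip_convex (b : ℝ) : Convex ℝ (strip b) := by
  have : strip b = Complex.reLm ⁻¹' (Metric.ball 0 b) := by
    ext w; simp [strip]
  rw [this]
  exact (convex_ball 0 b).linear_preimage _

lemma DD_deriv (hQ0 : 0 < Q) {b : ℝ} (hb0 : 0 < b) (hb : Real.exp b * Q < 1) (k : ℕ) {w : ℂ} (hw : w ∈ strip b) :
    HasDerivAt (DD Q k) (DD Q (k+1) w) w := by
  have h := hasDerivAt_tsum_of_isPreconnected (g := fun (n : ℤ) (w : ℂ) => tm Q k w n)
    (g' := fun (n : ℤ) (w : ℂ) => tm Q (k+1) w n) (t := strip b)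
    (u := fun n : ℤ => 2 * ((n.natAbs:ℝ)^(k+1) * (Real.exp b * Q) ^ n.natAbs)) (y₀ := 0)
    ((summable_natAbs_geom (by positivity) hb (k+1)).mul_left 2) (strip_open b) (strip_convex b).isPreconnected
    ?_ (fun n y hy => tm_bound hQ0 (k+1) n (le_of_lt hy)) (by simpa [strip] using hb0)
    (tm_summable hQ0 hb k (w := 0) (by simpa using hb0.le)).of_norm hw
  · exact h
  · intro n y hy
    unfold tm
    have := (((hasDerivAt_id y).const_mul (n:ℂ)).cexp).const_mul ((n:ℂ)^k * (sc Q n : ℂ))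
    refine this.congr_deriv ?_
    simp only [id]
    ring

lemma DD_cube (hQ0 : 0 < Q) (hQ1 : Q < 1) : ∃ C : ℝ, ∀ (b : ℝ), Real.exp b * Q < 1 → ∀ w : ℂ, |w.re| ≤ b →
    DD Q 0 w ^ 3 = C * DD Q 0 w + 2 * DD Q 2 w := by
  obtain ⟨C, hC⟩ := ppsc_hasSum hQ0 hQ1
  refine ⟨C, fun b hb w hw => ?_⟩
  have hs := tm_summable hQ0 hb 0 hw
  have hS := DD_hasSum hQ0 hb 0 hw
  have h2 := (conv_hasSum hs hs hS hS).2
  have hs2 := hs.hasSum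
  have h2n := (conv_hasSum_real hs2 hs2).2
  have en : ∀ n m : ℤ, Complex.exp (m*w) * Complex.exp (((n - m : ℤ):ℂ)*w) = Complex.exp (n*w) := by
    intro n m; rw [← Complex.exp_add]; congr 1; push_cast; ring
  have e1 : ∀ n, ∑' m, tm Q 0 w m * tm Q 0 w (n - m) = (pp Q n : ℂ) * Complex.exp (n * w) := by
    intro n
    unfold pp
    rw [Complex.ofReal_tsum, ← tsum_mul_right]
    refine tsum_congr fun m => ?_
    unfold tm
    rw [← en n m]; push_cast; ring
  have e2 : ∀ n, ∑' m, ‖tm Q 0 w m‖ * ‖tm Q 0 w (n - m)‖ = ‖(pp Q n : ℂ) * Complex.exp (n * w)‖ := by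
    intro n
    have hp : 0 ≤ pp Q n := tsum_nonneg fun m => (mul_pos (sc_pos hQ0 _) (sc_pos hQ0 _)).le
    rw [norm_mul, Complex.norm_real, Real.norm_of_nonneg hp]
    unfold pp
    rw [← tsum_mul_right]
    refine tsum_congr fun m => ?_
    unfold tm
    rw [← en n m]
    simp only [norm_mul, pow_zero, norm_one, Complex.norm_real, Real.norm_of_nonneg (sc_pos hQ0 _).le]
    ring
  simp_rw [e1] at h2
  simp_rw [e2] at h2n
  have h3 := (conv_hasSum h2n.summable hs h2 hS).2
  have h4 := ((DD_hasSum hQ0 hb 0 hw).mul_left (C:ℂ)).add ((DD_hasSum hQ0 hb 2 hw).mul_left 2)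
  have h5 := h3.unique (h4.congr_fun fun n => ?_)
  · rw [← h5]; ring
  · have h6 := (hC n).tsum_eq
    have : ∑' m, (pp Q m : ℂ) * Complex.exp (m * w) * tm Q 0 w (n - m) = 
        ((∑' m, pp Q m * sc Q (n - m) : ℝ) : ℂ) * Complex.exp (n * w) := by
      rw [Complex.ofReal_tsum, ← tsum_mul_right]
      refine tsum_congr fun m => ?_
      unfold tm
      rw [← en n m]; push_cast; ring
    rw [this, h6]
    unfold tm
    push_cast
    ring

lemma tsum_odd_zero {f : ℤ → ℂ} (h : ∀ n, f (-n) = - f n) : ∑' n, f n = 0 := by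
  have h1 := (Equiv.neg ℤ).tsum_eq f
  simp only [Equiv.neg_apply, h, tsum_neg] at h1
  have : (2:ℂ) * ∑' n, f n = 0 := by linear_combination -h1
  simpa using this

end
end RF

namespace RF

noncomputable def ab (q : ℝ) (n : ℕ) : ℝ := q^n * (1 - q^(2*n)) / (1 + q^(4*n))

lemma pm_sq_sq {q : ℝ} (hq0 : 0 < q) (hq1 : q < 1) : pm (q^2)^2 = ph q * pm q := by
  obtain ⟨a, b⟩ := sq_lt hq0 hq1
  obtain ⟨c, d⟩ := p4_lt hq0 hq1
  rw [pm_eq a b, ph_eq hq0 hq1, pm_eq hq0 hq1, show (q^2)^2 = q^4 by ring]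
  have e1 := Eu_pos hq0 hq1
  have e2 := Eu_pos a b
  have e4 := Eu_pos c d
  field_simp

lemma ph_gt {q : ℝ} (hq0 : 0 < q) (hq1 : q < 1) : 0 < ph q^2 - ph (q^2)^2 := by
  have h1 := th_sq hq0 hq1 (ε := 1) (by norm_num)
  rw [← ph] at h1
  rw [h1, B_eq hq0 hq1]
  have h8 : 0 < q^8 ∧ q^8 < 1 := ⟨by positivity, pow_lt_one₀ hq0.le hq1 (by norm_num)⟩
  have e1 := Eu_pos h8.1 h8.2
  have e4 := Eu_pos (p4_lt hq0 hq1).1 (p4_lt hq0 hq1).2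
  have : 0 < 1 * q * (2 * Eu (q^8)^2 / Eu (q^4))^2 := by positivity
  linarith

lemma tm_log_pair {q : ℝ} (hq0 : 0 < q) (k : ℕ) (hk : Odd k) (n : ℕ) :
    tm (q^2) k (Real.log q) n + tm (q^2) k (Real.log q) (-(n:ℤ)) = ((-2 * ((n:ℝ)^k * ab q n) : ℝ) : ℂ) := by
  unfold tm
  rw [sc_neg]
  have e1 : Complex.exp (((n:ℤ):ℂ) * (Real.log q : ℂ)) = ((q^n : ℝ) : ℂ) := by
    rw [← Real.rpow_natCast, Real.rpow_def_of_pos hq0]; push_cast; rw [mul_comm]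
  have e2 : Complex.exp (((-(n:ℤ) : ℤ):ℂ) * (Real.log q : ℂ)) = (((q^n)⁻¹ : ℝ) : ℂ) := by
    rw [Complex.ofReal_inv, ← e1, ← Complex.exp_neg]; congr 1; push_cast; ring
  have e3 : ((-(n:ℤ) : ℤ) : ℂ)^k = - (n:ℂ)^k := by push_cast; rw [hk.neg_pow]
  rw [e1, e2, e3]
  unfold sc ab
  rw [zpow_neg, zpow_natCast]
  have : 0 < q^n := by positivity
  have h : (q^2)^n = (q^n)^2 := by ring
  have h1 : q^(2*n) = (q^n)^2 := by ring
  have h2 : q^(4*n) = (q^n)^4 := by ring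
  rw [h, h1, h2]
  generalize q^n = u at *
  have key : 2 / (u^2 + (u^2)⁻¹) * u - 2 / (u^2 + (u^2)⁻¹) * u⁻¹ = -2 * (u * (1 - u^2)/(1 + u^4)) := by
    field_simp; ring
  have : ((-2 * ((n:ℝ)^k * (u * (1 - u^2)/(1 + u^4))) : ℝ) : ℂ) =
     (((n:ℝ)^k * (2 / (u^2 + (u^2)⁻¹) * u - 2 / (u^2 + (u^2)⁻¹) * u⁻¹) : ℝ) : ℂ) := by rw [key]; congr 1; ring
  rw [this]; push_cast; ring

lemma DD_log {q : ℝ} (hq0 : 0 < q) {b : ℝ} (hb : Real.exp b * q^2 < 1) (hw : |Real.log q| ≤ b)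
    (k : ℕ) (hk : Odd k) : HasSum (fun n : ℕ => ((-2 * ((n:ℝ)^k * ab q n) : ℝ) : ℂ)) (DD (q^2) k (Real.log q)) := by
  have h := (DD_hasSum (Q := q^2) (by positivity) hb k (w := Real.log q) (by simpa using hw)).nat_add_neg
  refine hs_congr h (fun n => (tm_log_pair hq0 k hk n).symm) ?_
  simp [tm, hk.pos.ne']

lemma formA {q : ℝ} (hq0 : 0 < q) (hq1 : q < 1) :
    HasSum (fun n : ℕ => (n:ℝ)^3 * ab q n)
      (ph q * ph (q^2) * (ph q^2 - ph (q^2)^2) * (ph q^4 + 4 * ph q^2 * ph (q^2)^2 - ph (q^2)^4) / 16) := by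
  obtain ⟨a, b⟩ := sq_lt hq0 hq1
  set L := Real.log q with hL
  have hL0 : L < 0 := Real.log_neg hq0 hq1
  have hqL : q = Real.exp L := (Real.exp_log hq0).symm
  obtain ⟨B, hB⟩ : ∃ B, B = -(3/2) * L := ⟨_, rfl⟩
  have hB0 : 0 < B := by rw [hB]; linarith
  have hbQ : Real.exp B * q^2 < 1 := by
    rw [hqL, ← Real.exp_nat_mul, ← Real.exp_add, Real.exp_lt_one_iff, hB]; push_cast; linarith
  have hLB : |L| < B := by rw [abs_of_neg hL0, hB]; linarith
  obtain ⟨C, hC⟩ := DD_cube a b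
  have hode : ∀ w ∈ strip B, DD (q^2) 0 w ^ 3 = C * DD (q^2) 0 w + 2 * DD (q^2) 2 w :=
    fun w hw => hC B hbQ w (le_of_lt hw)
  have hd := fun k w (hw : w ∈ strip B) => DD_deriv a hB0 hbQ k hw
  have hmem0 : (0:ℂ) ∈ strip B := by simpa [strip] using hB0
  have hmempi : (Real.pi * Complex.I : ℂ) ∈ strip B := by simpa [strip] using hB0
  have hmemL : (L : ℂ) ∈ strip B := by simpa [strip] using hLB
  -- first integral
  have hconst : ∀ u ∈ strip B, ∀ v ∈ strip B,
      DD (q^2) 1 u ^2 - DD (q^2) 0 u^4/4 + C * DD (q^2) 0 u^2/2 = DD (q^2) 1 v ^2 - DD (q^2) 0 v^4/4 + C * DD (q^2) 0 v^2/2 := by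
    intro u hu v hv
    have hdF : ∀ w ∈ strip B, HasDerivAt (fun w => DD (q^2) 1 w ^2 - DD (q^2) 0 w^4/4 + C * DD (q^2) 0 w^2/2) 0 w := by
      intro w hw
      have h0 := hd 0 w hw
      have h1 := hd 1 w hw
      have := (((h1.pow 2).sub ((h0.pow 4).div_const 4)).add (((h0.pow 2).const_mul (C:ℂ)).div_const 2))
      refine this.congr_deriv ?_
      have := hode w hw
      push_cast
      linear_combination (-DD (q^2) 1 w) * this
    exact (strip_open B).is_const_of_deriv_eq_zero (strip_convex B).isPreconnected
      (fun w hw => (hdF w hw).differentiableAt.differentiableWithinAt) (fun w hw => (hdF w hw).deriv) hu hv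
  have hode3 : 3 * DD (q^2) 0 L ^ 2 * DD (q^2) 1 L = C * DD (q^2) 1 L + 2 * DD (q^2) 3 L := by
    have h1 := (hd 0 L hmemL).pow 3
    have h2 := ((hd 0 L hmemL).const_mul (C:ℂ)).add ((hd 2 L hmemL).const_mul 2)
    have h3 : (DD (q^2) 0 ^ 3) =ᶠ[nhds (L:ℂ)] ((fun w => (C:ℂ) * DD (q^2) 0 w) + fun w => 2 * DD (q^2) 2 w) := by
      filter_upwards [(strip_open B).mem_nhds hmemL] with w hw
      exact hode w hw
    have := h1.unique (h2.congr_of_eventuallyEq h3)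
    push_cast at this
    linear_combination this
  have d1_0 : DD (q^2) 1 0 = 0 := by
    apply tsum_odd_zero
    intro n; simp [tm, sc_neg]
  have epi : ∀ n : ℤ, Complex.exp (n * (Real.pi * Complex.I)) = (((-1)^n : ℝ) : ℂ) := by
    intro n; rw [Complex.exp_int_mul, Complex.exp_pi_mul_I]; push_cast; rfl
  have d1_pi : DD (q^2) 1 (Real.pi * Complex.I) = 0 := by
    apply tsum_odd_zero
    intro n
    unfold tm
    rw [epi, epi, sc_neg, zpow_neg, ← inv_zpow, show (-1:ℝ)⁻¹ = -1 by norm_num]; push_cast; ring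
  have d0_0 : DD (q^2) 0 0 = ((ph (q^2)^2 : ℝ) : ℂ) := by
    have := LD_one a b
    rw [lam_one a b, one_mul] at this
    rw [← this]
    unfold LD DD tm
    rw [Complex.ofReal_tsum]
    refine tsum_congr fun n => ?_
    simp
  have d0_pi : DD (q^2) 0 (Real.pi * Complex.I) = ((pm (q^2)^2 : ℝ) : ℂ) := by
    have := LD_neg_one a b
    rw [lam_one a b, one_mul] at this
    rw [← this]
    unfold LD DD tm
    rw [Complex.ofReal_tsum]
    refine tsum_congr fun n => ?_
    rw [epi]; push_cast; ring
  have d0_L : DD (q^2) 0 L = ((ph q * ph (q^2) : ℝ) : ℂ) := by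
    rw [← LD_half hq0 hq1]
    unfold LD DD tm
    rw [Complex.ofReal_tsum]
    refine tsum_congr fun n => ?_
    have : Complex.exp (n * (L:ℂ)) = ((q^n : ℝ) : ℂ) := by
      rw [Complex.exp_int_mul, ← Complex.ofReal_exp, ← hqL]; push_cast; rfl
    rw [this]; push_cast; ring
  have s1 := DD_log hq0 hbQ hLB.le 1 (by decide)
  have s3 := DD_log hq0 hbQ hLB.le 3 (by decide)
  obtain ⟨S1, hS1⟩ : ∃ S : ℝ, DD (q^2) 1 L = (S:ℂ) := ⟨∑' n : ℕ, (-2 * ((n:ℝ)^1 * ab q n)), by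
    rw [Complex.ofReal_tsum]; exact s1.tsum_eq.symm⟩
  obtain ⟨S3, hS3⟩ : ∃ S : ℝ, DD (q^2) 3 L = (S:ℂ) := ⟨∑' n : ℕ, (-2 * ((n:ℝ)^3 * ab q n)), by
    rw [Complex.ofReal_tsum]; exact s3.tsum_eq.symm⟩
  rw [← hL, hS1] at s1
  rw [← hL, hS3] at s3
  have s1 := Complex.hasSum_ofReal.mp s1
  have s3 := Complex.hasSum_ofReal.mp s3
  have hab : ∀ n, 0 ≤ ab q n := by
    intro n; unfold ab
    have : q^(2*n) ≤ 1 := pow_le_one₀ hq0.le hq1.le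
    have : 0 ≤ 1 - q^(2*n) := by linarith
    positivity
  have S1neg : S1 ≤ 0 := by
    refine s1.nonpos fun n => ?_
    have := hab n
    have : 0 ≤ (n:ℝ)^1 * ab q n := by positivity
    show -2 * ((n:ℝ)^1 * ab q n) ≤ 0
    linarith
  have c1 := hconst 0 hmem0 (Real.pi * Complex.I) hmempi
  have c2 := hconst 0 hmem0 L hmemL
  rw [d1_0, d1_pi, d0_0, d0_pi] at c1
  rw [d1_0, d0_0, d0_L, hS1] at c2
  rw [hS1, hS3, d0_L] at hode3
  have hpm : pm (q^2)^4 = ph q^2 * (2*ph (q^2)^2 - ph q^2) := by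
    rw [show pm (q^2)^4 = (pm (q^2)^2)^2 by ring, pm_sq_sq hq0 hq1, mul_pow]
    have := ph_sq_add hq0 hq1
    rw [show pm q^2 = 2*ph (q^2)^2 - ph q^2 by linarith]
  have hgt := ph_gt hq0 hq1
  have hx := ph_pos hq0 hq1
  have hy := ph_pos a b
  norm_cast at c1 c2 hode3
  generalize ph q = x at *
  generalize ph (q^2) = y at *
  generalize pm (q^2) = z at *
  have c1' : (y^4 - z^4) * (2 * C - (y^4 + z^4)) = 0 := by linear_combination 4 * c1
  have hne : y^4 - z^4 ≠ 0 := by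
    rw [hpm]
    have : 0 < (x^2-y^2)^2 := by positivity
    nlinarith
  have hCv : 2 * C = y^4 + x^2*(2*y^2-x^2) := by
    rcases mul_eq_zero.mp c1' with h | h
    · exact absurd h hne
    · rw [← hpm]; linarith
  have hS1v : S1^2 = (x*y*(x^2-y^2)/2)^2 := by
    linear_combination -c2 + (y^4/4 - x^2*y^2/4) * hCv
  have hS1w : S1 = -(x*y*(x^2-y^2)/2) := by
    have hp : 0 < x*y*(x^2-y^2)/2 := by positivity
    rcases sq_eq_sq_iff_eq_or_eq_neg.mp hS1v with h | h
    · linarith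
    · exact h
  refine hs_congr (s3.mul_left (-1/2)) (fun n => by ring) ?_
  rw [hS1w] at hode3
  linear_combination (-1/4) * hode3 + (1/8) * (x*y*(x^2-y^2)/2) * hCv

end RF

namespace RF

/-- the character as a function on integers -/
def cc (m : ℤ) : ℤ := ZMod.χ₈ (m : ZMod 8)

lemma cc_neg (m : ℤ) : cc (-m) = cc m := by
  unfold cc; push_cast
  generalize (m : ZMod 8) = a
  revert a; decide

lemma cc_zero : cc 0 = 0 := by decide

lemma cc_add_eight (m k : ℤ) : cc (8 * k + m) = cc m := by
  unfold cc; push_cast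
  rw [show (8 : ZMod 8) = 0 by decide]; simp

lemma cc_abs (m : ℤ) : |(cc m : ℝ)| ≤ 1 := by
  have : |cc m| ≤ 1 := by
    unfold cc
    generalize (m : ZMod 8) = a
    revert a; decide
  exact_mod_cast this

noncomputable def e1 (q : ℝ) : ℝ := ∑' p : ℕ+ × ℕ+, (cc p.1 : ℝ) * ((p.2 : ℝ)^3 * q ^ (p.1 * p.2 : ℕ))
noncomputable def e2 (q : ℝ) : ℝ := ∑' p : ℕ+ × ℕ+, (cc p.2 : ℝ) * ((p.2 : ℝ)^3 * q ^ (p.1 * p.2 : ℕ))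

lemma e_summable {q : ℝ} (hq0 : 0 < q) (hq1 : q < 1) (c : ℕ+ × ℕ+ → ℤ) (hc : ∀ p, |(c p : ℝ)| ≤ 1) :
    Summable fun p : ℕ+ × ℕ+ => (c p : ℝ) * ((p.2 : ℝ)^3 * q ^ (p.1 * p.2 : ℕ)) := by
  have h := summable_prod_mul_pow (𝕜 := ℝ) 3 (r := q) (by rwa [Real.norm_of_nonneg hq0.le])
  refine Summable.of_norm_bounded h.norm fun p => ?_
  rw [norm_mul, Real.norm_eq_abs]
  exact mul_le_of_le_one_left (norm_nonneg _) (hc p)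

lemma e1_hasSum {q : ℝ} (hq0 : 0 < q) (hq1 : q < 1) :
    HasSum (fun p : ℕ+ × ℕ+ => (cc p.1 : ℝ) * ((p.2 : ℝ)^3 * q ^ (p.1 * p.2 : ℕ))) (e1 q) :=
  (e_summable hq0 hq1 (fun p => cc p.1) fun _ => cc_abs _).hasSum

lemma e2_hasSum {q : ℝ} (hq0 : 0 < q) (hq1 : q < 1) :
    HasSum (fun p : ℕ+ × ℕ+ => (cc p.2 : ℝ) * ((p.2 : ℝ)^3 * q ^ (p.1 * p.2 : ℕ))) (e2 q) :=
  (e_summable hq0 hq1 (fun p => cc p.2) fun _ => cc_abs _).hasSum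

lemma cc_geom {x : ℝ} (hx0 : 0 < x) (hx1 : x < 1) :
    HasSum (fun m : ℕ+ => (cc m : ℝ) * x ^ (m:ℕ)) (x * (1 - x^2) / (1 + x^4)) := by
  have hs : Summable fun m : ℕ => (cc m : ℝ) * x ^ m := by
    refine Summable.of_norm_bounded (summable_geometric_of_lt_one hx0.le hx1) fun m => ?_
    rw [norm_mul, Real.norm_eq_abs, Real.norm_of_nonneg (by positivity)]
    exact mul_le_of_le_one_left (by positivity) (cc_abs _)
  have h1 := hs.sum_add_tsum_nat_add 8
  have h2 : ∀ m : ℕ, (cc ((m + 8 : ℕ) : ℤ) : ℝ) * x ^ (m+8) = x^8 * ((cc m : ℝ) * x^m) := by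
    intro m
    have : ((m + 8 : ℕ) : ℤ) = 8 * 1 + m := by push_cast; ring
    rw [this, cc_add_eight]; ring
  simp_rw [h2, tsum_mul_left] at h1
  simp only [Finset.sum_range_succ, Finset.sum_range_zero] at h1
  have v0 : cc ((0:ℕ):ℤ) = 0 := by decide
  have v1 : cc ((1:ℕ):ℤ) = 1 := by decide
  have v2 : cc ((2:ℕ):ℤ) = 0 := by decide
  have v3 : cc ((3:ℕ):ℤ) = -1 := by decide
  have v4 : cc ((4:ℕ):ℤ) = 0 := by decide
  have v5 : cc ((5:ℕ):ℤ) = -1 := by decide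
  have v6 : cc ((6:ℕ):ℤ) = 0 := by decide
  have v7 : cc ((7:ℕ):ℤ) = 1 := by decide
  rw [v0, v1, v2, v3, v4, v5, v6, v7] at h1
  push_cast at h1
  have hval : ∑' m : ℕ, (cc m : ℝ) * x ^ m = x * (1 - x^2) / (1 + x^4) := by
    have hx4 : x^4 < 1 := pow_lt_one₀ hx0.le hx1 (by norm_num)
    rw [eq_div_iff (by positivity)]
    have h4 : 1 - x^4 ≠ 0 := by linarith
    apply mul_left_cancel₀ h4
    linear_combination (-1) * h1
  have h3 := hs.hasSum
  rw [hval] at h3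
  have h4 := (Function.Injective.hasSum_iff PNat.coe_injective (f := fun m : ℕ => (cc m : ℝ) * x ^ m) 
    (a := x * (1 - x^2) / (1 + x^4)) ?_).mpr h3
  · exact h4
  · intro m hm
    have : m = 0 := by
      by_contra h
      exact hm ⟨⟨m, Nat.pos_of_ne_zero h⟩, rfl⟩
    subst this
    simp [cc_zero]

lemma e1_eq {q : ℝ} (hq0 : 0 < q) (hq1 : q < 1) : e1 q =
    ph q * ph (q^2) * (ph q^2 - ph (q^2)^2) * (ph q^4 + 4 * ph q^2 * ph (q^2)^2 - ph (q^2)^4) / 16 := by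
  have h := (Equiv.prodComm ℕ+ ℕ+).hasSum_iff.mpr (e1_hasSum hq0 hq1)
  have h2 := h.prod_fiberwise (g := fun d : ℕ+ => (d:ℝ)^3 * ab q d) (fun d => by
    have hx : 0 < q^(d:ℕ) ∧ q^(d:ℕ) < 1 := ⟨by positivity, pow_lt_one₀ hq0.le hq1 d.ne_zero⟩
    refine hs_congr ((cc_geom hx.1 hx.2).mul_left ((d:ℝ)^3)) (fun m => ?_) ?_
    · simp only [Function.comp, Equiv.prodComm_apply, Prod.swap]
      rw [mul_comm (m:ℕ), pow_mul]; ring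
    · unfold ab; rw [mul_comm 2, mul_comm 4, pow_mul, pow_mul])
  have h3 := (Function.Injective.hasSum_iff PNat.coe_injective (f := fun d : ℕ => (d:ℝ)^3 * ab q d) ?_).mpr (formA hq0 hq1)
  · exact h2.unique h3
  · intro m hm
    have : m = 0 := by
      by_contra h
      exact hm ⟨⟨m, Nat.pos_of_ne_zero h⟩, rfl⟩
    subst this
    simp

/-! ### Lipschitz -/

lemma lip {z : ℂ} (hz : 0 < z.im) : HasSum (fun n : ℤ => ((z + n)^4)⁻¹)
    ((2*π)^4/6 * ∑' d : ℕ+, (d:ℂ)^3 * Complex.exp (2 * π * I * z) ^ (d:ℕ)) := by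
  have h := EisensteinSeries.qExpansion_identity_pnat (k := 3) (by norm_num) ⟨z, hz⟩
  have hs := EisensteinSeries.linear_right_summable z 1 (k := 4) (by norm_num)
  have hs2 : Summable fun n : ℤ => ((z + n)^4)⁻¹ := by
    refine hs.congr fun n => ?_
    simp only [Int.cast_one, one_mul]
    norm_cast
  have := hs2.hasSum
  refine hs_congr this (fun n => rfl) ?_
  simp only [one_div, Nat.reduceAdd] at h
  refine Eq.trans ?_ h.symm
  congr 1
  have : I^4 = 1 := Complex.I_pow_four
  simp only [Nat.factorial]
  push_cast
  linear_combination (-(16*π^4/6 : ℂ)) * this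

noncomputable def zt : ℂ := Complex.exp (2 * π * I / 8)

lemma zt_sq : zt^2 = I := by
  unfold zt
  rw [← Complex.exp_nat_mul]
  refine Eq.trans ?_ Complex.exp_pi_div_two_mul_I
  congr 1; push_cast; ring

lemma zt_I : zt * (1 - I) = (√2 : ℝ) := by
  unfold zt
  rw [show 2 * π * I / 8 = ((π/4 : ℝ) : ℂ) * I by push_cast; ring, Complex.exp_mul_I, ← Complex.ofReal_cos,
    ← Complex.ofReal_sin, Real.cos_pi_div_four, Real.sin_pi_div_four]
  push_cast
  linear_combination (-(√2/2 : ℂ)) * Complex.I_sq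

lemma gauss (d : ℕ) : ∑ r : Fin 8, (cc (r:ℕ) : ℂ) * zt ^ ((r:ℕ) * d) = 2 * (√2 : ℝ) * (cc d : ℂ) := by
  have v0 : cc ((0:ℕ):ℤ) = 0 := by decide
  have v1 : cc ((1:ℕ):ℤ) = 1 := by decide
  have v2 : cc ((2:ℕ):ℤ) = 0 := by decide
  have v3 : cc ((3:ℕ):ℤ) = -1 := by decide
  have v4 : cc ((4:ℕ):ℤ) = 0 := by decide
  have v5 : cc ((5:ℕ):ℤ) = -1 := by decide
  have v6 : cc ((6:ℕ):ℤ) = 0 := by decide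
  have v7 : cc ((7:ℕ):ℤ) = 1 := by decide
  have hI := Complex.I_sq
  have h4 : zt^4 = -1 := by rw [show zt^4 = (zt^2)^2 by ring, zt_sq, hI]
  have h8 : zt^8 = 1 := by rw [show zt^8 = (zt^4)^2 by ring, h4]; norm_num
  have hd : (cc d) = cc ((d % 8 : ℕ)) := by
    conv_lhs => rw [← Nat.div_add_mod d 8]
    push_cast
    rw [cc_add_eight]
  have hz : zt^d = zt^(d%8) := by
    conv_lhs => rw [← Nat.div_add_mod d 8, pow_add, pow_mul, h8, one_pow, one_mul]
  have hsum : ∑ r : Fin 8, (cc (r:ℕ) : ℂ) * zt ^ ((r:ℕ) * d) = 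
      zt^d - (zt^d)^3 - (zt^d)^5 + (zt^d)^7 := by
    rw [Fin.sum_univ_eight]
    simp only [Fin.isValue, show ((0 : Fin 8) : ℕ) = 0 from rfl, show ((1 : Fin 8) : ℕ) = 1 from rfl,
      show ((2 : Fin 8) : ℕ) = 2 from rfl, show ((3 : Fin 8) : ℕ) = 3 from rfl, show ((4 : Fin 8) : ℕ) = 4 from rfl,
      show ((5 : Fin 8) : ℕ) = 5 from rfl, show ((6 : Fin 8) : ℕ) = 6 from rfl, show ((7 : Fin 8) : ℕ) = 7 from rfl]
    rw [v0, v1, v2, v3, v4, v5, v6, v7]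
    push_cast
    ring
  rw [hsum, hz, hd]
  have hlt : d % 8 < 8 := Nat.mod_lt _ (by norm_num)
  have e := zt_I
  have e2 := zt_sq
  have h3 : zt^3 = I * zt := by rw [← e2]; ring
  have h5 : zt^5 = - zt := by linear_combination zt * h4
  have h6 : zt^6 = - I := by linear_combination zt^2 * h4 - e2
  have h7 : zt^7 = - I * zt := by linear_combination zt^3 * h4 - h3
  have h9 : zt^9 = zt := by linear_combination zt * h8
  have h15 : zt^15 = - I * zt := by linear_combination zt^7 * h8 + h7
  have h21 : zt^21 = - zt := by linear_combination zt^5 * (zt^8 + 1) * h8 + h5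
  have hI4 := Complex.I_pow_four
  have key : ∀ j : ℕ, Odd j → zt^j - (zt^j)^3 - (zt^j)^5 + (zt^j)^7 = 2 * (zt^j - zt^(j*3)) := by
    intro j hj
    have : (zt^j)^4 = -1 := by rw [← pow_mul, mul_comm, pow_mul, h4, hj.neg_one_pow]
    rw [pow_mul]
    linear_combination ((zt^j)^3 - zt^j) * this
  generalize d % 8 = j at *
  rw [← e]
  interval_cases j
  · rw [v0]; simp
  · rw [key 1 (by decide), v1, h3]; push_cast; ring
  · rw [v2, e2]; simp only [Int.cast_zero, mul_zero]; linear_combination (I^3 - I) * hI4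
  · rw [key 3 (by decide), v3, h3, h9]; push_cast; ring
  · rw [v4, h4]; norm_num
  · rw [key 5 (by decide), v5, h5, h15]; push_cast; ring
  · rw [v6, h6]; simp only [Int.cast_zero, mul_zero]; linear_combination (I - I^3) * hI4
  · rw [key 7 (by decide), v7, h7, h21]; push_cast; ring

end RF

namespace RF

lemma norm_exp_lt {z : ℂ} (hz : 0 < z.im) : ‖Complex.exp (2 * π * I * z)‖ < 1 := by
  rw [Complex.norm_exp, Real.exp_lt_one_iff]
  have : (2 * π * I * z).re = -(2 * π * z.im) := by simp
  rw [this]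
  have := Real.pi_pos
  have : 0 < 2 * π * z.im := by positivity
  linarith

lemma pnat_summable {x : ℂ} (hx : ‖x‖ < 1) : Summable fun d : ℕ+ => (d:ℂ)^3 * x^(d:ℕ) := by
  have h := summable_pow_mul_geometric_of_norm_lt_one (R := ℂ) 3 hx
  exact h.comp_injective PNat.coe_injective

lemma Tn {z : ℂ} (hz : 0 < z.im) : HasSum (fun m : ℤ => (cc m : ℂ) * ((m + 8 * z)^4)⁻¹)
    ((8^4)⁻¹ * ((2*π)^4/6) * (2 * (√2:ℝ)) * ∑' d : ℕ+, (cc d : ℂ) * ((d:ℂ)^3 * Complex.exp (2 * π * I * z) ^ (d:ℕ))) := by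
  have hs0 := EisensteinSeries.linear_right_summable (8*z) 1 (k := 4) (by norm_num)
  have hs : Summable fun m : ℤ => (cc m : ℂ) * ((m + 8 * z)^4)⁻¹ := by
    refine Summable.of_norm_bounded hs0.norm fun n => ?_
    rw [norm_mul, Complex.norm_intCast, Int.cast_one, one_mul, add_comm]
    exact mul_le_of_le_one_left (norm_nonneg _) (cc_abs n)
  have h1 := hs.hasSum
  have h2 := (Int.divModEquiv 8).symm.hasSum_iff.mpr h1
  have h3 := (Equiv.prodComm (Fin 8) ℤ).hasSum_iff.mpr h2
  have him : ∀ r : Fin 8, 0 < (z + (r:ℕ)/8).im := by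
    intro r
    have : ((((r:ℕ):ℝ)/8 : ℝ) : ℂ).im = 0 := Complex.ofReal_im _
    push_cast at this
    rw [Complex.add_im, this, add_zero]; exact hz
  have h4 := h3.prod_fiberwise (g := fun r : Fin 8 => (cc (r:ℕ) : ℂ) * ((8^4)⁻¹ * ((2*π)^4/6 *
      ∑' d : ℕ+, (d:ℂ)^3 * Complex.exp (2 * π * I * (z + (r:ℕ)/8)) ^ (d:ℕ)))) (fun r => by
    refine hs_congr (((lip (him r)).mul_left ((8^4 : ℂ)⁻¹)).mul_left (cc (r:ℕ) : ℂ)) (fun k => ?_) rfl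
    simp only [Function.comp, Equiv.prodComm_apply, Prod.swap, Int.divModEquiv_symm_apply]
    have e : cc (k * (8:ℕ) + ((r:ℕ):ℤ)) = cc (r:ℕ) := by
      rw [show k * ((8:ℕ):ℤ) + ((r:ℕ):ℤ) = 8 * k + (r:ℕ) by push_cast; ring, cc_add_eight]
    rw [e, ← mul_inv]
    congr 2
    push_cast
    ring)
  have h5 := (hasSum_fintype _).unique h4
  rw [← h5] at h1
  refine hs_congr h1 (fun _ => rfl) ?_
  have hx := norm_exp_lt hz
  have ex : ∀ (r : Fin 8) (d : ℕ+), Complex.exp (2 * π * I * (z + (r:ℕ)/8)) ^ (d:ℕ) =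
      Complex.exp (2 * π * I * z)^(d:ℕ) * zt ^((r:ℕ)*(d:ℕ)) := by
    intro r d
    unfold zt
    rw [← Complex.exp_nat_mul, ← Complex.exp_nat_mul, ← Complex.exp_nat_mul, ← Complex.exp_add]
    congr 1; push_cast; ring
  have hsr : ∀ r ∈ (Finset.univ : Finset (Fin 8)), Summable fun d : ℕ+ => (cc (r:ℕ) : ℂ) * ((8^4)⁻¹ * ((2*π)^4/6 *
      ((d:ℂ)^3 * Complex.exp (2 * π * I * (z + (r:ℕ)/8)) ^ (d:ℕ)))) := by
    intro r _
    exact (((pnat_summable (norm_exp_lt (him r))).mul_left _).mul_left _).mul_left _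
  simp_rw [← tsum_mul_left]
  rw [← Summable.tsum_finsetSum hsr]
  refine tsum_congr fun d => ?_
  simp_rw [ex]
  have g := gauss d
  have : ∑ r : Fin 8, (cc (r:ℕ) : ℂ) * ((8^4)⁻¹ * ((2*π)^4/6 *
      ((d:ℂ)^3 * (Complex.exp (2 * π * I * z)^(d:ℕ) * zt ^((r:ℕ)*(d:ℕ)))))) = 
      ((8^4)⁻¹ * ((2*π)^4/6 * ((d:ℂ)^3 * Complex.exp (2 * π * I * z)^(d:ℕ)))) *
        ∑ r : Fin 8, (cc (r:ℕ) : ℂ) * zt ^ ((r:ℕ) * (d:ℕ)) := by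
    rw [Finset.mul_sum]
    refine Finset.sum_congr rfl fun r _ => ?_
    ring
  rw [this, g]
  ring

lemma exp_is (s : ℝ) : Complex.exp (2 * π * I * (s * I)) = ((Real.exp (-(2 * π * s)) : ℝ) : ℂ) := by
  push_cast
  congr 1
  linear_combination (2 * π * s) * Complex.I_sq

lemma exp_lt {s : ℝ} (hs : 0 < s) : 0 < Real.exp (-(2 * π * s)) ∧ Real.exp (-(2 * π * s)) < 1 := by
  refine ⟨Real.exp_pos _, Real.exp_lt_one_iff.mpr ?_⟩
  have := Real.pi_pos
  have : 0 < 2 * π * s := by positivity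
  linarith

lemma e1_c {s : ℝ} (hs : 0 < s) : ((e1 (Real.exp (-(2*π*s))) : ℝ) : ℂ) = ∑' m : ℕ+, (cc m : ℂ) * 
    ∑' d : ℕ+, (d:ℂ)^3 * Complex.exp (2*π*I*(m * (s * I)))^(d:ℕ) := by
  have h := (e1_hasSum (exp_lt hs).1 (exp_lt hs).2)
  have h2 := (h.prod_fiberwise fun m => (h.summable.prod_factor m).hasSum).tsum_eq
  rw [← h2, Complex.ofReal_tsum]
  refine tsum_congr fun m => ?_
  rw [Complex.ofReal_tsum, ← tsum_mul_left]
  refine tsum_congr fun d => ?_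
  have : Complex.exp (2*π*I*(m * (s * I))) = Complex.exp (2*π*I*(s*I))^(m:ℕ) := by
    rw [← Complex.exp_nat_mul]; congr 1; ring
  rw [this, exp_is, ← pow_mul]
  push_cast; rfl

lemma e2_c {s : ℝ} (hs : 0 < s) : ((e2 (Real.exp (-(2*π*s))) : ℝ) : ℂ) = ∑' m : ℕ+, 
    ∑' d : ℕ+, (cc d : ℂ) * ((d:ℂ)^3 * Complex.exp (2*π*I*(m * (s * I)))^(d:ℕ)) := by
  have h := (e2_hasSum (exp_lt hs).1 (exp_lt hs).2)
  have h2 := (h.prod_fiberwise fun m => (h.summable.prod_factor m).hasSum).tsum_eq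
  rw [← h2, Complex.ofReal_tsum]
  refine tsum_congr fun m => ?_
  rw [Complex.ofReal_tsum]
  refine tsum_congr fun d => ?_
  have : Complex.exp (2*π*I*(m * (s * I))) = Complex.exp (2*π*I*(s*I))^(m:ℕ) := by
    rw [← Complex.exp_nat_mul]; congr 1; ring
  rw [this, exp_is, ← pow_mul]
  push_cast; rfl

lemma S_transform : ∃ T : ℝ, ∀ s : ℝ, 0 < s →
    e1 (Real.exp (-(2*π*(1/(8*s))))) = s^4 * (T + 2 * √2 * e2 (Real.exp (-(2*π*s)))) := by
  set T0 : ℂ := ∑' m : ℤ, (cc m : ℂ) * ((m:ℂ)^4)⁻¹ with hT0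
  refine ⟨(8^4 * 6 / (2 * (2*π)^4)) * T0.re, fun s hs => ?_⟩
  set s' : ℝ := 1/(8*s) with hs'
  have hs'0 : 0 < s' := by positivity
  have him : 0 < ((s':ℂ) * I).im := by simpa using hs'0
  let z : UpperHalfPlane := ⟨(s':ℂ) * I, him⟩
  have hz : (z : ℂ) = (s':ℂ) * I := rfl
  have hsum : Summable fun p : ℤ × ℤ => (cc p.1 : ℂ) * ((p.1 * ((s':ℂ) * I) + p.2)^4)⁻¹ := by
    refine Summable.of_norm_bounded ((EisensteinSeries.summable_norm_eisSummand (k := 4) (by norm_num) z).of_norm |> fun h => (finTwoArrowEquiv ℤ).symm.summable_iff.mpr h).norm fun p => ?_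
    rw [norm_mul, Complex.norm_intCast]
    refine (mul_le_of_le_one_left (norm_nonneg _) (cc_abs _)).trans (le_of_eq ?_)
    congr 1
  have L1 : ∑' p : ℤ × ℤ, (cc p.1 : ℂ) * ((p.1 * ((s':ℂ) * I) + p.2)^4)⁻¹ = 
      2 * ((2*π)^4/6 * (e1 (Real.exp (-(2*π*s'))) : ℝ)) := by
    rw [hsum.tsum_prod, tsum_int_eq_zero_add_two_mul_tsum_pnat]
    · dsimp only
      rw [e1_c hs'0, ← tsum_mul_left, cc_zero]
      simp only [Int.cast_zero, zero_mul, tsum_zero, zero_add, nsmul_eq_mul, Nat.cast_ofNat]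
      congr 1
      refine tsum_congr fun m => ?_
      rw [tsum_mul_left]
      have him' : 0 < ((m:ℂ) * ((s':ℂ) * I)).im := by
        have : (0:ℝ) < m := by exact_mod_cast m.pos
        simp
        positivity
      have := (lip him').tsum_eq
      simp only [Int.cast_natCast]
      rw [this]; ring
    · intro m
      dsimp only
      rw [cc_neg]
      nth_rewrite 1 [← tsum_comp_neg]
      refine tsum_congr fun n => ?_
      push_cast
      ring_nf
    · exact hsum.prod
  have hsI : ∀ m n : ℤ, ((m * ((s':ℂ) * I) + n)^4)⁻¹ = (8*s)^4 * ((m + 8 * (-n * (s * I)))^4)⁻¹ := by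
    intro m n
    have h1 : (m * ((s':ℂ) * I) + n) = (I / (8*s)) * (m + 8 * (-n * (s * I))) := by
      have : (s:ℂ) ≠ 0 := by exact_mod_cast hs.ne'
      rw [hs']; push_cast
      field_simp
      linear_combination (8 * n * s : ℂ) * Complex.I_sq
    rw [h1, mul_pow, mul_inv, div_pow, Complex.I_pow_four]
    congr 1
    rw [one_div, inv_inv]
  have hsum2 := hsum.prod_symm
  have L2 : ∑' p : ℤ × ℤ, (cc p.1 : ℂ) * ((p.1 * ((s':ℂ) * I) + p.2)^4)⁻¹ = 
      (8*s)^4 * (T0 + 2 * ((8^4)⁻¹ * ((2*π)^4/6) * (2 * (√2:ℝ)) * (e2 (Real.exp (-(2*π*s))) : ℝ))) := by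
    rw [← (Equiv.prodComm ℤ ℤ).tsum_eq]
    simp only [Equiv.prodComm_apply]
    rw [hsum2.tsum_prod]
    simp only [Prod.swap, Prod.fst, Prod.snd, hsI]
    have : ∀ n : ℤ, ∑' m : ℤ, (cc m : ℂ) * ((8*s)^4 * ((m + 8 * (-n * (s * I)))^4)⁻¹) = 
      (8*s)^4 * ∑' m : ℤ, (cc m : ℂ) * ((m + 8 * (n * (s * I)))^4)⁻¹ := by
      intro n
      rw [← tsum_mul_left, ← tsum_comp_neg]
      refine tsum_congr fun m => ?_
      rw [cc_neg]; push_cast; ring_nf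
    simp_rw [this]
    rw [tsum_mul_left, tsum_int_eq_zero_add_two_mul_tsum_pnat]
    · congr 1
      rw [e2_c hs, ← tsum_mul_left]
      simp only [nsmul_eq_mul, Nat.cast_ofNat]
      congr 1
      · simp [hT0]
      · congr 1
        refine tsum_congr fun n => ?_
        have him' : 0 < ((n:ℂ) * ((s:ℂ) * I)).im := by
          have : (0:ℝ) < n := by exact_mod_cast n.pos
          simp
          positivity
        have := (Tn him').tsum_eq
        simp only [Int.cast_natCast]
        rw [this]
    · intro n
      dsimp only
      nth_rewrite 1 [← tsum_comp_neg]
      refine tsum_congr fun m => ?_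
      rw [cc_neg]; push_cast; ring_nf
    · have h := hsum2.prod
      simp only [Prod.swap, Prod.fst, Prod.snd, hsI, this] at h
      refine (h.mul_left ((8*s:ℂ)^4)⁻¹).congr fun n => ?_
      have : (s:ℂ) ≠ 0 := by exact_mod_cast hs.ne'
      field_simp
  have h := L1.symm.trans L2
  have hre := congrArg Complex.re h
  have c1 : (2 * ((2*π)^4/6 * (e1 (Real.exp (-(2*π*s'))) : ℝ)) : ℂ) = ((2 * ((2*π)^4/6 * e1 (Real.exp (-(2*π*s')))) : ℝ) : ℂ) := by
    push_cast; rfl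
  have c2 : ((8*s)^4 * (T0 + 2 * ((8^4)⁻¹ * ((2*π)^4/6) * (2 * (√2:ℝ)) * (e2 (Real.exp (-(2*π*s))) : ℝ))) : ℂ) =
    (((8*s)^4 : ℝ) : ℂ) * (T0 + ((2 * ((8^4)⁻¹ * ((2*π)^4/6) * (2 * √2) * e2 (Real.exp (-(2*π*s)))) : ℝ) : ℂ)) := by
    push_cast; rfl
  rw [c1, c2, Complex.ofReal_re, Complex.re_ofReal_mul, Complex.add_re, Complex.ofReal_re] at hre
  have := Real.pi_pos
  field_simp at hre ⊢
  linarith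

end RF

namespace RF

lemma ph_exp (a : ℝ) : ph (Real.exp (-(π * a))) = ∑' n : ℤ, Real.exp (-π * a * (n:ℝ)^2) := by
  unfold ph th
  refine tsum_congr fun n => ?_
  rw [one_zpow, mul_one, ← Real.rpow_intCast, ← Real.exp_mul]
  congr 1
  push_cast; ring

lemma ph_transform {a : ℝ} (ha : 0 < a) :
    ph (Real.exp (-(π * (1/a)))) = √a * ph (Real.exp (-(π * a))) := by
  rw [ph_exp, ph_exp, Real.tsum_exp_neg_mul_int_sq ha, ← Real.sqrt_eq_rpow]
  have h0 : √a ≠ 0 := (Real.sqrt_pos.mpr ha).ne'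
  rw [← mul_assoc, mul_one_div_cancel h0, one_mul]
  refine tsum_congr fun n => ?_
  congr 1
  ring

lemma formB : ∃ K : ℝ, ∀ q : ℝ, 0 < q → q < 1 → K + 2 * e2 q =
    ph q * ph (q^2) * (2 * ph (q^2)^2 - ph q^2) * (4 * ph (q^2)^4 + 8 * ph q^2 * ph (q^2)^2 - ph q^4) := by
  obtain ⟨T, hT⟩ := S_transform
  refine ⟨T / √2, fun q hq0 hq1 => ?_⟩
  obtain ⟨s, hs, rfl⟩ : ∃ s : ℝ, 0 < s ∧ q = Real.exp (-(2*π*s)) := by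
    have hl := Real.log_neg hq0 hq1
    refine ⟨-Real.log q / (2*π), by have := Real.pi_pos; apply div_pos; linarith; positivity, ?_⟩
    have : -(2*π*(-Real.log q / (2*π))) = Real.log q := by
      field_simp
    rw [this, Real.exp_log hq0]
  have h := hT s hs
  have hs' : 0 < 1/(8*s) := by positivity
  have E := e1_eq (exp_lt hs').1 (exp_lt hs').2
  have X : ph (Real.exp (-(2*π*(1/(8*s))))) = √(4*s) * ph (Real.exp (-(2*π*s))^2) := by
    have := ph_transform (a := 4*s) (by positivity)
    convert this using 3
    · congr 1; field_simp; norm_num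
    · rw [← Real.exp_nat_mul]; congr 1; push_cast; ring
  have Y : ph (Real.exp (-(2*π*(1/(8*s))))^2) = √(2*s) * ph (Real.exp (-(2*π*s))) := by
    have := ph_transform (a := 2*s) (by positivity)
    convert this using 3
    · rw [← Real.exp_nat_mul]; congr 1; push_cast; field_simp; norm_num
    · congr 1; ring
  rw [h, X, Y] at E
  generalize ph (Real.exp (-(2*π*s))) = x at *
  generalize ph (Real.exp (-(2*π*s))^2) = y at *
  generalize e2 (Real.exp (-(2*π*s))) = e at *
  have r4 : √(4*s) = √2 * √(2*s) := by
    rw [← Real.sqrt_mul (by norm_num)]; congr 1; ring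
  have h2 : √2^2 = 2 := Real.sq_sqrt (by norm_num)
  have hu : √(2*s)^2 = 2*s := Real.sq_sqrt (by positivity)
  have h20 : 0 < √2 := by positivity
  rw [r4] at E
  generalize √2 = r at *
  generalize √(2*s) = u at *
  have E2 : s^4 * (T + 2 * r * e) = s^4 * (r * (x*y*(2*y^2-x^2)*(4*y^4+8*x^2*y^2-x^4))) := by
    rw [E]
    have : r * u * y * (u * x) * ((r * u * y)^2 - (u*x)^2) * ((r*u*y)^4 + 4 * (r*u*y)^2*(u*x)^2 - (u*x)^4)
      = r * (u^2)^4 * (x * y * (r^2*y^2 - x^2) * ((r^2)^2*y^4 + 4*r^2*x^2*y^2 - x^4)) := by ring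
    rw [this, h2, hu]; ring
  have E3 := mul_left_cancel₀ (by positivity) E2
  have : T / r + 2 * e = (T + 2 * r * e) / r := by field_simp
  rw [this, E3]
  field_simp

lemma sig1_hasSum {q : ℝ} (hq0 : 0 < q) (hq1 : q < 1) :
    HasSum (fun n : ℕ+ => (sigmaChi8One n : ℝ) * q ^ (n:ℕ)) (e1 q) := by
  have h := e1_hasSum hq0 hq1
  rw [← sigmaAntidiagonalEquivProd.hasSum_iff] at h
  have h2 := h.sigma (g := fun n : ℕ+ => (sigmaChi8One n : ℝ) * q ^ (n:ℕ)) fun n => ?_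
  · exact h2
  · refine hs_congr (hasSum_fintype _) (fun x => rfl) ?_
    simp only [Function.comp, sigmaAntidiagonalEquivProd, Equiv.coe_fn_mk, divisorsAntidiagonalFactors, PNat.mk_coe]
    rw [Finset.univ_eq_attach, Finset.sum_attach _ (fun x : ℕ × ℕ => (cc x.1 : ℝ) * ((x.2:ℝ)^3 * q^(x.1*x.2))),
      Nat.sum_divisorsAntidiagonal' (f := fun a b : ℕ => (cc a : ℝ) * ((b:ℝ)^3 * q^(a*b)))]
    unfold sigmaChi8One
    rw [Int.cast_sum, Finset.sum_mul]
    refine Finset.sum_congr rfl fun d hd => ?_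
    rw [Nat.div_mul_cancel (Nat.dvd_of_mem_divisors hd)]
    simp only [cc, Int.cast_mul, Int.cast_pow, Int.cast_natCast]
    ring

lemma sig2_hasSum {q : ℝ} (hq0 : 0 < q) (hq1 : q < 1) :
    HasSum (fun n : ℕ+ => (sigmaOneChi8 n : ℝ) * q ^ (n:ℕ)) (e2 q) := by
  have h := e2_hasSum hq0 hq1
  rw [← sigmaAntidiagonalEquivProd.hasSum_iff] at h
  have h2 := h.sigma (g := fun n : ℕ+ => (sigmaOneChi8 n : ℝ) * q ^ (n:ℕ)) fun n => ?_
  · exact h2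
  · refine hs_congr (hasSum_fintype _) (fun x => rfl) ?_
    simp only [Function.comp, sigmaAntidiagonalEquivProd, Equiv.coe_fn_mk, divisorsAntidiagonalFactors, PNat.mk_coe]
    rw [Finset.univ_eq_attach, Finset.sum_attach _ (fun x : ℕ × ℕ => (cc x.2 : ℝ) * ((x.2:ℝ)^3 * q^(x.1*x.2))),
      Nat.sum_divisorsAntidiagonal' (f := fun a b : ℕ => (cc b : ℝ) * ((b:ℝ)^3 * q^(a*b)))]
    unfold sigmaOneChi8
    push_cast
    rw [Finset.sum_mul]
    refine Finset.sum_congr rfl fun d hd => ?_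
    rw [Nat.div_mul_cancel (Nat.dvd_of_mem_divisors hd)]
    simp only [cc, Int.cast_natCast]
    ring

end RF

namespace RF

lemma hasSum_mul_gen {α β : Type*} {f : α → ℝ} {g : β → ℝ} {a b : ℝ} (hf : HasSum f a) (hg : HasSum g b) :
    HasSum (fun p : α × β => f p.1 * g p.2) (a * b) := by
  have hs := summable_mul_of_summable_norm hf.summable.norm hg.summable.norm
  have := hf.mul hg hs
  exact this

lemma hasSum_pi_prod (k : ℕ) (f : Fin k → ℤ → ℝ) (s : Fin k → ℝ) (h : ∀ i, HasSum (f i) (s i)) :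
    HasSum (fun x : Fin k → ℤ => ∏ i, f i (x i)) (∏ i, s i) := by
  induction k with
  | zero =>
    simp
  | succ k ih =>
    have h1 := ih (fun i => f i.succ) (fun i => s i.succ) (fun i => h i.succ)
    have h2 := hasSum_mul_gen (h 0) h1
    rw [← (Fin.consEquiv (fun _ => ℤ)).hasSum_iff, Fin.prod_univ_succ]
    refine hs_congr h2 (fun p => ?_) rfl
    simp [Fin.prod_univ_succ]

def qf (a : Fin 8 → ℕ) (x : Fin 8 → ℤ) : ℕ := ∑ i, a i * (x i).natAbs^2

lemma qf_iff (a : Fin 8 → ℕ) (x : Fin 8 → ℤ) (n : ℕ) :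
    qf a x = n ↔ ∑ i, (a i : ℤ) * x i ^ 2 = (n : ℤ) := by
  rw [← Int.natCast_inj, qf]
  push_cast
  simp [sq_abs]

lemma rep_hasSum {q : ℝ} (hq0 : 0 < q) (hq1 : q < 1) (a : Fin 8 → ℕ) (ha : ∀ i, a i ≠ 0) :
    HasSum (fun n : ℕ => (repCount a n : ℝ) * q ^ n) (∏ i, ph (q ^ (a i))) := by
  have h : HasSum (fun x : Fin 8 → ℤ => q ^ (qf a x)) (∏ i, ph (q ^ (a i))) := by
    refine hs_congr (hasSum_pi_prod 8 (fun i n => (q ^ (a i)) ^ (n^2) * 1 ^ n) _ 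
      fun i => hasSum_th (by positivity) (pow_lt_one₀ hq0.le hq1 (ha i))) (fun x => ?_) rfl
    rw [qf, ← Finset.prod_pow_eq_pow_sum]
    refine Finset.prod_congr rfl fun i _ => ?_
    rw [one_zpow, mul_one, pow_mul, ← zpow_natCast (q ^ a i)]
    congr 1
    push_cast
    rw [sq_abs]
  rw [← (Equiv.sigmaFiberEquiv (qf a)).hasSum_iff] at h
  refine h.sigma fun n => ?_
  have hs := h.summable.sigma_factor n
  have e : ∀ c : {x // qf a x = n}, (fun x : Fin 8 → ℤ => q ^ (qf a x)) ((Equiv.sigmaFiberEquiv (qf a)) ⟨n, c⟩) = q^n := by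
    intro c
    simp [Equiv.sigmaFiberEquiv, c.2]
  have hs2 : Summable (fun c : {x // qf a x = n} => q^n) := hs.congr fun c => e c
  refine hs_congr hs2.hasSum e ?_
  rw [tsum_const, nsmul_eq_mul]
  congr 2
  unfold repCount
  exact Nat.card_congr (Equiv.subtypeEquivRight fun x => (qf_iff a x n).symm)

end RF

namespace RF

lemma eta_real {t : ℝ} (ht : 0 < t) : dedekindEta (t * I) =
    ((Real.exp (-(π * t / 12)) * Eu (Real.exp (-(2*π*t))) : ℝ) : ℂ) := by
  have h := (Eu_mult (exp_lt ht).1 (exp_lt ht).2).hasProd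
  have h2 := (h.map Complex.ofRealHom Complex.continuous_ofReal).tprod_eq
  unfold dedekindEta
  rw [Complex.ofReal_mul]
  congr 1
  · push_cast
    congr 1
    linear_combination (π * t / 12) * Complex.I_sq
  · rw [Eu]
    refine Eq.trans ?_ h2
    refine tprod_congr fun m => ?_
    simp only [Function.comp, Complex.ofRealHom_eq_coe]
    push_cast
    rw [← Complex.exp_nat_mul]
    congr 2
    push_cast
    linear_combination (2 * π * t * (m+1)) * Complex.I_sq

noncomputable def F1 (q : ℝ) : ℝ := q * Eu (q^2)^11 * Eu (q^8)^2 / (Eu q^2 * Eu (q^4)^3)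
noncomputable def F2 (q : ℝ) : ℝ := q * Eu q^2 * Eu (q^4)^11 / (Eu (q^2)^3 * Eu (q^8)^2)

lemma p8_lt {q : ℝ} (hq0 : 0 < q) (hq1 : q < 1) : 0 < q^8 ∧ q^8 < 1 :=
  ⟨by positivity, pow_lt_one₀ hq0.le hq1 (by norm_num)⟩

lemma F1_pos {q : ℝ} (hq0 : 0 < q) (hq1 : q < 1) : 0 < F1 q := by
  have h1 := Eu_pos hq0 hq1
  have h2 := Eu_pos (sq_lt hq0 hq1).1 (sq_lt hq0 hq1).2
  have h4 := Eu_pos (p4_lt hq0 hq1).1 (p4_lt hq0 hq1).2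
  have h8 := Eu_pos (p8_lt hq0 hq1).1 (p8_lt hq0 hq1).2
  unfold F1; positivity

lemma F2_pos {q : ℝ} (hq0 : 0 < q) (hq1 : q < 1) : 0 < F2 q := by
  have h1 := Eu_pos hq0 hq1
  have h2 := Eu_pos (sq_lt hq0 hq1).1 (sq_lt hq0 hq1).2
  have h4 := Eu_pos (p4_lt hq0 hq1).1 (p4_lt hq0 hq1).2
  have h8 := Eu_pos (p8_lt hq0 hq1).1 (p8_lt hq0 hq1).2
  unfold F2; positivity

lemma pieces {q : ℝ} (hq0 : 0 < q) (hq1 : q < 1) :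
    ph (q^2) = Eu (q^4)^5 / (Eu (q^2)^2 * Eu (q^8)^2) ∧
    2 * ph (q^2)^2 - ph q^2 = (Eu q^2 / Eu (q^2))^2 ∧
    ph q^2 - ph (q^2)^2 = q * (2 * Eu (q^8)^2 / Eu (q^4))^2 := by
  refine ⟨?_, ?_, ?_⟩
  · rw [ph_eq (sq_lt hq0 hq1).1 (sq_lt hq0 hq1).2, ← pow_mul, ← pow_mul]
  · rw [← pm_eq hq0 hq1, ← ph_sq_add hq0 hq1]; ring
  · have h1 := th_sq hq0 hq1 (ε := 1) (by norm_num)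
    rw [← ph] at h1
    rw [h1, B_eq hq0 hq1]; ring

lemma F1_eq {q : ℝ} (hq0 : 0 < q) (hq1 : q < 1) : F1 q =
    ph q^3 * ph (q^2) * (2 * ph (q^2)^2 - ph q^2) * (ph q^2 - ph (q^2)^2) / 4 := by
  have h1 := Eu_pos hq0 hq1
  have h2 := Eu_pos (sq_lt hq0 hq1).1 (sq_lt hq0 hq1).2
  have h4 := Eu_pos (p4_lt hq0 hq1).1 (p4_lt hq0 hq1).2
  have h8 := Eu_pos (p8_lt hq0 hq1).1 (p8_lt hq0 hq1).2
  obtain ⟨a, b, c⟩ := pieces hq0 hq1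
  rw [b, c, a, ph_eq hq0 hq1, F1]
  field_simp
  ring

lemma F2_eq {q : ℝ} (hq0 : 0 < q) (hq1 : q < 1) : F2 q =
    ph q * ph (q^2)^3 * (2 * ph (q^2)^2 - ph q^2) * (ph q^2 - ph (q^2)^2) / 4 := by
  have h1 := Eu_pos hq0 hq1
  have h2 := Eu_pos (sq_lt hq0 hq1).1 (sq_lt hq0 hq1).2
  have h4 := Eu_pos (p4_lt hq0 hq1).1 (p4_lt hq0 hq1).2
  have h8 := Eu_pos (p8_lt hq0 hq1).1 (p8_lt hq0 hq1).2
  obtain ⟨a, b, c⟩ := pieces hq0 hq1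
  rw [b, c, a, ph_eq hq0 hq1, F2]
  field_simp
  ring

lemma exists_s {q : ℝ} (hq0 : 0 < q) (hq1 : q < 1) : ∃ s : ℝ, 0 < s ∧ q = Real.exp (-(2*π*s)) := by
  have hl := Real.log_neg hq0 hq1
  refine ⟨-Real.log q / (2*π), by have := Real.pi_pos; apply div_pos; linarith; positivity, ?_⟩
  have : -(2*π*(-Real.log q / (2*π))) = Real.log q := by
    field_simp
  rw [this, Real.exp_log hq0]

lemma eta_k {s : ℝ} (hs : 0 < s) (k : ℕ) (hk : 0 < k) : dedekindEta ((k:ℂ) * (s * I)) =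
    ((Real.exp (-(π * s / 12))^k * Eu (Real.exp (-(2*π*s))^k) : ℝ) : ℂ) := by
  have hk' : (0:ℝ) < k := by exact_mod_cast hk
  have := eta_real (t := k * s) (by positivity)
  rw [← Real.exp_nat_mul, ← Real.exp_nat_mul]
  convert this using 2
  · push_cast; ring
  · congr 2
    · ring
    · congr 1; ring

lemma series_of {a : ℕ → ℤ} {q F : ℝ} (hF : F ≠ 0)
    (h : (F : ℂ) = ∑' m : ℕ, (a (m + 1) : ℂ) * (q:ℂ) ^ (m + 1)) :
    HasSum (fun m : ℕ => (a (m+1) : ℝ) * q ^ (m+1)) F := by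
  have hs : Summable fun m : ℕ => (a (m + 1) : ℂ) * (q:ℂ) ^ (m + 1) := by
    by_contra hc
    rw [tsum_eq_zero_of_not_summable hc] at h
    exact hF (by exact_mod_cast h)
  have := hs.hasSum
  rw [← h] at this
  rw [← Complex.hasSum_ofReal]
  refine hs_congr this (fun m => ?_) rfl
  push_cast; rfl

lemma eta_vals {s : ℝ} (hs : 0 < s) : ∃ r : ℝ, 0 < r ∧ r^24 = Real.exp (-(2*π*s)) ∧
    dedekindEta (s * I) = ((r * Eu (Real.exp (-(2*π*s))) : ℝ) : ℂ) ∧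
    dedekindEta (2 * (s * I)) = ((r^2 * Eu (Real.exp (-(2*π*s))^2) : ℝ) : ℂ) ∧
    dedekindEta (4 * (s * I)) = ((r^4 * Eu (Real.exp (-(2*π*s))^4) : ℝ) : ℂ) ∧
    dedekindEta (8 * (s * I)) = ((r^8 * Eu (Real.exp (-(2*π*s))^8) : ℝ) : ℂ) := by
  refine ⟨Real.exp (-(π * s / 12)), Real.exp_pos _, ?_, eta_real hs, ?_, ?_, ?_⟩
  · rw [← Real.exp_nat_mul]; congr 1; push_cast; ring
  · simpa using eta_k hs 2 (by norm_num)
  · simpa using eta_k hs 4 (by norm_num)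
  · simpa using eta_k hs 8 (by norm_num)

lemma a1_hasSum (a1 : ℕ → ℤ) (ha1 : ∀ z : ℂ, 0 < z.im →
      dedekindEta z ^ (-2 : ℤ) * dedekindEta (2 * z) ^ (11 : ℤ) * dedekindEta (4 * z) ^ (-3 : ℤ) * dedekindEta (8 * z) ^ (2 : ℤ)
        = ∑' m : ℕ, (a1 (m + 1) : ℂ) * Complex.exp (2 * Real.pi * Complex.I * z) ^ (m + 1))
    {q : ℝ} (hq0 : 0 < q) (hq1 : q < 1) : HasSum (fun m : ℕ => (a1 (m+1) : ℝ) * q ^ (m+1)) (F1 q) := by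
  refine series_of (F1_pos hq0 hq1).ne' ?_
  have h1 := (Eu_pos hq0 hq1).ne'
  have h4 := (Eu_pos (p4_lt hq0 hq1).1 (p4_lt hq0 hq1).2).ne'
  obtain ⟨s, hs, rfl⟩ := exists_s hq0 hq1
  obtain ⟨r, hr, hr24, e1, e2, e4, e8⟩ := eta_vals hs
  have := ha1 (s * I) (by simpa using hs)
  rw [exp_is] at this
  rw [← this, e1, e2, e4, e8]
  generalize Real.exp (-(2*π*s)) = q at *
  norm_cast
  rw [F1]
  simp only [zpow_negSucc, Nat.reduceAdd]
  have hr' := hr.ne'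
  rw [← hr24] at *
  field_simp

lemma a2_hasSum (a2 : ℕ → ℤ) (ha2 : ∀ z : ℂ, 0 < z.im →
      dedekindEta z ^ (2 : ℤ) * dedekindEta (2 * z) ^ (-3 : ℤ) * dedekindEta (4 * z) ^ (11 : ℤ) * dedekindEta (8 * z) ^ (-2 : ℤ)
        = ∑' m : ℕ, (a2 (m + 1) : ℂ) * Complex.exp (2 * Real.pi * Complex.I * z) ^ (m + 1))
    {q : ℝ} (hq0 : 0 < q) (hq1 : q < 1) : HasSum (fun m : ℕ => (a2 (m+1) : ℝ) * q ^ (m+1)) (F2 q) := by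
  refine series_of (F2_pos hq0 hq1).ne' ?_
  have h2 := (Eu_pos (sq_lt hq0 hq1).1 (sq_lt hq0 hq1).2).ne'
  have h8 := (Eu_pos (p8_lt hq0 hq1).1 (p8_lt hq0 hq1).2).ne'
  obtain ⟨s, hs, rfl⟩ := exists_s hq0 hq1
  obtain ⟨r, hr, hr24, e1, e2, e4, e8⟩ := eta_vals hs
  have := ha2 (s * I) (by simpa using hs)
  rw [exp_is] at this
  rw [← this, e1, e2, e4, e8]
  generalize Real.exp (-(2*π*s)) = q at *
  norm_cast
  rw [F2]
  simp only [zpow_negSucc, Nat.reduceAdd]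
  have hr' := hr.ne'
  rw [← hr24] at *
  field_simp

end RF

namespace RF

lemma coeff_zero {c : ℕ → ℝ} (h : ∀ q : ℝ, 0 < q → q < 1 → HasSum (fun n => c n * q^n) 0) : c 0 = 0 := by
  have hhalf := (h (1/2) (by norm_num) (by norm_num)).summable
  have hC := ((summable_nat_add_iff 1).mpr hhalf).norm
  set C := ∑' n : ℕ, ‖c (n+1) * (1/2:ℝ)^(n+1)‖ with hCdef
  have hC0 : 0 ≤ C := tsum_nonneg fun n => norm_nonneg _
  have bound : ∀ q : ℝ, 0 < q → q ≤ 1/2 → |c 0| ≤ 2 * q * C := by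
    intro q hq hq2
    have hq1 : q < 1 := by linarith
    have hs := h q hq hq1
    have h0 := hs.summable.tsum_eq_zero_add
    rw [hs.tsum_eq, pow_zero, mul_one] at h0
    have : c 0 = - ∑' n : ℕ, c (n+1) * q^(n+1) := by linarith
    rw [this, abs_neg, ← Real.norm_eq_abs]
    have hb := hC.hasSum.mul_left (2*q)
    refine tsum_of_norm_bounded hb fun n => ?_
    rw [norm_mul, norm_mul, Real.norm_of_nonneg (by positivity : (0:ℝ) ≤ q^(n+1)), Real.norm_of_nonneg (by positivity : (0:ℝ) ≤ (1/2:ℝ)^(n+1))]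
    have : q^n ≤ (1/2:ℝ)^n := pow_le_pow_left₀ hq.le hq2 n
    have h3 : q^(n+1) ≤ 2 * q * (1/2:ℝ)^(n+1) := by
      rw [pow_succ, pow_succ]; nlinarith
    calc _ ≤ ‖c (n+1)‖ * (2 * q * (1/2:ℝ)^(n+1)) := by gcongr
      _ = _ := by ring
  by_contra hc
  have hp : 0 < |c 0| := abs_pos.mpr hc
  have := bound (min (1/2) (|c 0| / (4 * (C+1)))) (by positivity) (min_le_left _ _)
  have h2 : min (1/2) (|c 0| / (4 * (C+1))) ≤ |c 0| / (4 * (C+1)) := min_le_right _ _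
  have h3 : 2 * min (1/2) (|c 0| / (4 * (C+1))) * C ≤ 2 * (|c 0| / (4 * (C+1))) * C := by gcongr
  have h4 : 2 * (|c 0| / (4 * (C+1))) * C = |c 0| * (C / (2 * (C+1))) := by field_simp; ring
  have h5 : C / (2 * (C+1)) < 1 := by rw [div_lt_one (by positivity)]; linarith
  nlinarith

lemma coeff_all (n : ℕ) : ∀ {c : ℕ → ℝ}, (∀ q : ℝ, 0 < q → q < 1 → HasSum (fun n => c n * q^n) 0) → c n = 0 := by
  induction n with
  | zero => intro c h; exact coeff_zero h
  | succ n ih =>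
    intro c h
    refine ih (c := fun n => c (n+1)) fun q hq hq1 => ?_
    have h0 := coeff_zero h
    have := (hasSum_nat_add_iff' 1).mpr (h q hq hq1)
    refine hs_congr (this.mul_left q⁻¹) (fun m => ?_) (by simp [h0])
    field_simp
    ring

lemma shift_hasSum {g : ℕ → ℝ} {a : ℝ} (h : HasSum (fun m : ℕ => g (m+1)) a) (h0 : g 0 = 0) : HasSum g a := by
  have := (hasSum_nat_add_iff 1).mp h
  simpa [h0] using this

lemma pnat_hasSum {g : ℕ → ℝ} {a : ℝ} (h : HasSum (fun m : ℕ+ => g m) a) (h0 : g 0 = 0) : HasSum g a := by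
  refine shift_hasSum ?_ h0
  rw [← Equiv.pnatEquivNat.symm.hasSum_iff] at h
  refine hs_congr h (fun m => ?_) rfl
  simp

lemma half_hasSum {c : ℕ → ℝ} {q a : ℝ} (h : HasSum (fun m : ℕ => c m * (q^2)^m) a) :
    HasSum (fun m : ℕ => (if 2 ∣ m then c (m/2) else 0) * q^m) a := by
  have hi : Function.Injective (fun m : ℕ => 2 * m) := fun a b h => by simpa using h
  rw [← hi.hasSum_iff]
  · refine hs_congr h (fun m => ?_) rfl
    simp [pow_mul]
  · intro m hm
    rw [if_neg, zero_mul]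
    rintro ⟨k, rfl⟩
    exact hm ⟨k, rfl⟩

end RF

namespace RF

lemma main_identity : ∃ K : ℝ, ∀ q : ℝ, 0 < q → q < 1 → 
    11 * (ph q * ph (q^2) * ph (q^4)^6) = 2 * e1 q + (K + 2 * e2 (q^2)) + 6 * F1 q + 14 * F2 q
      + 48 * F1 (q^2) - 28 * F2 (q^2) := by
  obtain ⟨K, hK⟩ := formB
  refine ⟨K, fun q hq0 hq1 => ?_⟩
  have h2 := sq_lt hq0 hq1
  rw [e1_eq hq0 hq1, hK _ h2.1 h2.2, F1_eq hq0 hq1, F2_eq hq0 hq1, F1_eq h2.1 h2.2, F2_eq h2.1 h2.2]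
  have e : (q^2)^2 = q^4 := by ring
  rw [e]
  have r1 := ph_add_pm hq0 hq1
  have r2 := ph_sq_add hq0 hq1
  have hp : pm q = 2 * ph (q^4) - ph q := by linarith
  rw [hp] at r2
  generalize ph q = x at *
  generalize ph (q^2) = y at *
  generalize ph (q^4) = w at *
  have hY : y^2 = 2*w^2 - 2*x*w + x^2 := by linarith
  have key : ∀ Y : ℝ, Y = 2*w^2 - 2*x*w + x^2 → 11 * (x * w^6) = 
      2 * (x * (x^2-Y)*(x^4+4*x^2*Y-Y^2)/16)
      + (w * (2*w^2-Y)*(4*w^4+8*Y*w^2-Y^2))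
      + 6 * (x^3*(2*Y-x^2)*(x^2-Y)/4) + 14 * (x*Y*(2*Y-x^2)*(x^2-Y)/4)
      + 48 * (Y*w*(2*w^2-Y)*(Y-w^2)/4) - 28 * (w^3*(2*w^2-Y)*(Y-w^2)/4) := by
    rintro _ rfl
    ring
  linear_combination y * key (y^2) hY

end RF

theorem representation_formula_0
    (a1 a2 : ℕ → ℤ)
    (ha1 : ∀ z : ℂ, 0 < z.im →
      dedekindEta z ^ (-2 : ℤ) * dedekindEta (2 * z) ^ (11 : ℤ) * dedekindEta (4 * z) ^ (-3 : ℤ) * dedekindEta (8 * z) ^ (2 : ℤ)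
        = ∑' m : ℕ, (a1 (m + 1) : ℂ) * Complex.exp (2 * Real.pi * Complex.I * z) ^ (m + 1))
    (ha2 : ∀ z : ℂ, 0 < z.im →
      dedekindEta z ^ (2 : ℤ) * dedekindEta (2 * z) ^ (-3 : ℤ) * dedekindEta (4 * z) ^ (11 : ℤ) * dedekindEta (8 * z) ^ (-2 : ℤ)
        = ∑' m : ℕ, (a2 (m + 1) : ℂ) * Complex.exp (2 * Real.pi * Complex.I * z) ^ (m + 1))
    (n : ℕ) (hn : 0 < n) :
    (repCount ![1, 2, 4, 4, 4, 4, 4, 4] n : ℚ) =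
    (((2 : ℚ) / 11) * (sigmaChi8One n : ℚ) + ((2 : ℚ) / 11) * half sigmaOneChi8 n
      + ((6 : ℚ) / 11) * (a1 n : ℚ) + ((14 : ℚ) / 11) * (a2 n : ℚ)
      + ((48 : ℚ) / 11) * half a1 n + ((-28 : ℚ) / 11) * half a2 n) := by
  obtain ⟨K, hK⟩ := RF.main_identity
  have hzero : ∀ f : ℕ → ℤ, (half f n : ℝ) = if 2 ∣ n then (f (n/2) : ℝ) else 0 := by
    intro f
    unfold half
    split_ifs <;> simp
  have hn0 : n ≠ 0 := hn.ne'
  let A : (ℕ → ℤ) → ℕ → ℝ := fun a m => if m = 0 then 0 else (a m : ℝ)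
  let c : ℕ → ℝ := fun m => 11 * (repCount ![1, 2, 4, 4, 4, 4, 4, 4] m : ℝ) - 2 * (sigmaChi8One m : ℝ)
    - (if m = 0 then K else 0) - 2 * (if 2 ∣ m then (sigmaOneChi8 (m/2) : ℝ) else 0)
    - 6 * A a1 m - 14 * A a2 m - 48 * (if 2 ∣ m then A a1 (m/2) else 0) + 28 * (if 2 ∣ m then A a2 (m/2) else 0)
  have hA : ∀ (a : ℕ → ℤ) (q F : ℝ), HasSum (fun m : ℕ => (a (m+1) : ℝ) * q ^ (m+1)) F →
      HasSum (fun m : ℕ => A a m * q^m) F := by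
    intro a q F h
    refine RF.shift_hasSum (RF.hs_congr h (fun m => ?_) rfl) (by simp [A])
    simp [A]
  have hc : c n = 0 := by
    refine RF.coeff_all n fun q hq0 hq1 => ?_
    have h2 := RF.sq_lt hq0 hq1
    have s0 := RF.rep_hasSum hq0 hq1 ![1, 2, 4, 4, 4, 4, 4, 4] (by decide)
    have s1 := RF.pnat_hasSum (g := fun m : ℕ => (sigmaChi8One m : ℝ) * q^m) (RF.sig1_hasSum hq0 hq1)
      (by simp [sigmaChi8One])
    have s2 := RF.half_hasSum (RF.pnat_hasSum (g := fun m : ℕ => (sigmaOneChi8 m : ℝ) * (q^2)^m)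
      (RF.sig2_hasSum h2.1 h2.2) (by simp [sigmaOneChi8]))
    have s3 := hA a1 q _ (RF.a1_hasSum a1 ha1 hq0 hq1)
    have s4 := hA a2 q _ (RF.a2_hasSum a2 ha2 hq0 hq1)
    have s5 := RF.half_hasSum (hA a1 _ _ (RF.a1_hasSum a1 ha1 h2.1 h2.2))
    have s6 := RF.half_hasSum (hA a2 _ _ (RF.a2_hasSum a2 ha2 h2.1 h2.2))
    have sK : HasSum (fun m : ℕ => (if m = 0 then K else 0) * q^m) K := by
      have := hasSum_single (f := fun m : ℕ => (if m = 0 then K else 0) * q^m) 0 (fun m hm => by simp [hm])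
      simpa using this
    have tot := (((((((s0.mul_left 11).sub (s1.mul_left 2)).sub sK).sub (s2.mul_left 2)).sub (s3.mul_left 6)).sub
      (s4.mul_left 14)).sub (s5.mul_left 48)).add (s6.mul_left 28)
    refine RF.hs_congr tot (fun m => ?_) ?_
    · simp only [c]; ring
    · have := hK q hq0 hq1
      simp only [Fin.prod_univ_succ]
      simp
      linarith
  have hAn : ∀ a, A a n = (a n : ℝ) := fun a => by simp [A, hn0]
  have hAh : ∀ a : ℕ → ℤ, (if 2 ∣ n then A a (n/2) else 0) = (half a n : ℝ) := by
    intro a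
    rw [hzero]
    split_ifs with hd
    · have : n / 2 ≠ 0 := by omega
      simp only [A, if_neg this]
    · rfl
  simp only [c, hAn, hAh, if_neg hn0, ← hzero] at hc
  have : ((repCount ![1, 2, 4, 4, 4, 4, 4, 4] n : ℚ) : ℝ) =
    (((((2 : ℚ) / 11) * (sigmaChi8One n : ℚ) + ((2 : ℚ) / 11) * half sigmaOneChi8 n
      + ((6 : ℚ) / 11) * (a1 n : ℚ) + ((14 : ℚ) / 11) * (a2 n : ℚ)
      + ((48 : ℚ) / 11) * half a1 n + ((-28 : ℚ) / 11) * half a2 n) : ℚ) : ℝ) := by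
    push_cast
    linarith
  exact_mod_cast this
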